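/- arXiv:1103.3423 — 2 statements merged into one kernel-verified Lean document; each statement's English description precedes it below -/
import Mathlib

section
/- Let k ≥ 1 and n ≥ 2k+1. There is a constant c(k,n) > 0 with the following property: let X be a finite k-dimensional simplicial complex in which every vertex lies in at most L k-dimensional faces, and suppose X has combinatorial width at least W over ℝ^k. If I is a topological embedding of |X| into ℝⁿ with combinatorial thickness at least 1, then the Lebesgue measure of the open 1-neighborhood of I(|X|) is at least c(k,n)·(W/L)^{n/(n−k)}. -/
open scoped Classical
open Metric Set Function MeasureTheory

/-- An embedding `I` of the polyhedron of a geometric simplicial complex `X` has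
combinatorial thickness at least `T` if the images of the convex hulls of any two
disjoint faces are at Euclidean distance at least `T` from each other. -/
def HasCombThickness {E F : Type*} [NormedAddCommGroup E] [NormedSpace ℝ E]
    [NormedAddCommGroup F] [NormedSpace ℝ F]
    (X : Geometry.SimplicialComplex ℝ E) (I : X.space → F) (T : ℝ) : Prop :=
  ∀ s ∈ X.faces, ∀ t ∈ X.faces, Disjoint s t →
    ∀ x y : X.space, (x : E) ∈ convexHull ℝ (s : Set E) →
      (y : E) ∈ convexHull ℝ (t : Set E) → T ≤ dist (I x) (I y)

/-- A `k`-dimensional simplicial complex `X` has combinatorial width at least `W` over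
`ℝᵏ` if every continuous map `F` from its polyhedron to `ℝᵏ` has a fiber meeting the
convex hulls of at least `W` distinct `k`-dimensional faces of `X`. -/
def HasCombWidthGE {E : Type*} [NormedAddCommGroup E] [NormedSpace ℝ E]
    (X : Geometry.SimplicialComplex ℝ E) (k W : ℕ) : Prop :=
  ∀ F : X.space → EuclideanSpace ℝ (Fin k), Continuous F →
    ∃ y : EuclideanSpace ℝ (Fin k),
      W ≤ {s : Finset E | s ∈ X.faces ∧ s.card = k + 1 ∧
        ∃ x : X.space, F x = y ∧ (x : E) ∈ convexHull ℝ (s : Set E)}.ncard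

lemma aux_gchar {ι : Type} [Fintype ι] (a : ι → ℝ) :
    ∫ x : ι → ℝ, Complex.exp (((∑ i, a i * x i : ℝ) : ℂ) * Complex.I)
      ∂(Measure.pi fun _ => ProbabilityTheory.gaussianReal 0 1)
    = ((Real.exp (-(∑ i, a i ^ 2) / 2) : ℝ) : ℂ) := by
  have h1 : ∀ x : ι → ℝ, Complex.exp (((∑ i, a i * x i : ℝ) : ℂ) * Complex.I)
      = ∏ i, Complex.exp ((a i : ℂ) * (x i : ℂ) * Complex.I) := by
    intro x
    rw [← Complex.exp_sum]
    congr 1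
    push_cast
    rw [Finset.sum_mul]
  simp_rw [h1]
  rw [integral_fintype_prod_eq_prod
    (f := fun i (x : ℝ) => Complex.exp ((a i : ℂ) * (x : ℂ) * Complex.I))]
  have h2 : ∀ t : ℝ, ∫ x : ℝ, Complex.exp ((t : ℂ) * (x : ℂ) * Complex.I)
      ∂(ProbabilityTheory.gaussianReal 0 1) = Complex.exp (-(t : ℂ) ^ 2 / 2) := by
    intro t
    rw [← MeasureTheory.charFun_apply_real, ProbabilityTheory.charFun_gaussianReal]
    congr 1
    simp
    ring
  simp_rw [h2]
  rw [← Complex.exp_sum]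
  push_cast
  congr 1
  rw [← Finset.sum_div, Finset.sum_neg_distrib]

lemma aux_gdom (f : ℝ → ℝ) (hf : ∀ x, 0 ≤ f x) (hi : Integrable f) :
    ∫ x, f x ∂(ProbabilityTheory.gaussianReal 0 1) ≤ ∫ x, f x := by
  rw [ProbabilityTheory.integral_gaussianReal_eq_integral_smul one_ne_zero]
  refine integral_mono_of_nonneg ?_ hi ?_
  · exact Filter.Eventually.of_forall fun x => by
      simp only [smul_eq_mul]
      exact mul_nonneg (ProbabilityTheory.gaussianPDFReal_nonneg _ _ _) (hf x)
  · refine Filter.Eventually.of_forall fun x => ?_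
    simp only [smul_eq_mul]
    refine mul_le_of_le_one_left (hf x) ?_
    rw [ProbabilityTheory.gaussianPDFReal_def]
    simp only [NNReal.coe_one, mul_one, sub_zero]
    have h1 : (1 : ℝ) ≤ √(2 * Real.pi) := by
      rw [Real.one_le_sqrt]
      linarith [Real.pi_gt_three]
    have h2 : (√(2 * Real.pi))⁻¹ ≤ 1 := inv_le_one_of_one_le₀ h1
    have h3 : Real.exp (-x ^ 2 / 2) ≤ 1 := by
      rw [Real.exp_le_one_iff]
      nlinarith [sq_nonneg x]
    calc _ ≤ (1 : ℝ) * 1 := mul_le_mul h2 h3 (Real.exp_pos _).le zero_le_one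
      _ = 1 := one_mul 1

lemma aux_theta (t : ℝ) (ht : 0 < t) (T : Finset ℤ) :
    ∑ m ∈ T, Real.exp (-(t ^ 2 * (m : ℝ) ^ 2) / 2) ≤ 4 * (1 + 1 / t) := by
  set r := Real.exp (-t) with hr
  have hr0 : 0 < r := Real.exp_pos _
  have hr1 : r ≤ 1 / (1 + t) := by
    rw [hr, Real.exp_neg, ← one_div]
    exact one_div_le_one_div_of_le (by linarith) (by linarith [Real.add_one_le_exp t])
  have hr2 : r < 1 := by rw [hr, Real.exp_lt_one_iff]; linarith
  have hs : HasSum (fun m : ℤ => r ^ m.natAbs) ((1 - r)⁻¹ + r * (1 - r)⁻¹) := by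
    refine HasSum.of_nat_of_neg_add_one ?_ ?_
    · simpa using hasSum_geometric_of_lt_one hr0.le hr2
    · have : ∀ n : ℕ, r ^ (-((n : ℤ) + 1)).natAbs = r * r ^ n := by
        intro n
        have : (-((n : ℤ) + 1)).natAbs = n + 1 := by omega
        rw [this, pow_succ, mul_comm]
      simp_rw [this]
      exact (hasSum_geometric_of_lt_one hr0.le hr2).mul_left r
  have hb : ∀ m : ℤ, Real.exp (-(t ^ 2 * (m : ℝ) ^ 2) / 2) ≤ 2 * r ^ m.natAbs := by
    intro m
    have h1 : r ^ m.natAbs = Real.exp (-(t * |(m : ℝ)|)) := by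
      rw [hr, ← Real.exp_nat_mul, Nat.cast_natAbs, Int.cast_abs]
      congr 1
      ring
    have h2 : Real.exp (1 / 2) ≤ 2 := by
      have h3 : Real.exp (1 / 2) ^ 2 = Real.exp 1 := by
        rw [← Real.exp_nat_mul]; norm_num
      nlinarith [Real.exp_one_lt_d9, Real.exp_pos (1 / 2 : ℝ)]
    calc Real.exp (-(t ^ 2 * (m : ℝ) ^ 2) / 2)
        ≤ Real.exp (1 / 2 + -(t * |(m : ℝ)|)) := by
          rw [Real.exp_le_exp, ← sq_abs (m : ℝ)]
          nlinarith [sq_nonneg (t * |(m : ℝ)| - 1)]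
      _ = Real.exp (1 / 2) * r ^ m.natAbs := by rw [Real.exp_add, h1]
      _ ≤ _ := by gcongr
  calc _ ≤ ∑ m ∈ T, 2 * r ^ m.natAbs := Finset.sum_le_sum fun m _ => hb m
    _ = 2 * ∑ m ∈ T, r ^ m.natAbs := by rw [Finset.mul_sum]
    _ ≤ 2 * ((1 - r)⁻¹ + r * (1 - r)⁻¹) := by
        gcongr
        exact sum_le_hasSum T (fun m _ => by positivity) hs
    _ ≤ 2 * (2 * (1 + 1 / t)) := by
        have h3 : (1 - r)⁻¹ ≤ 1 + 1 / t := by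
          rw [inv_le_comm₀ (by linarith) (by positivity)]
          have : (1 + 1 / t)⁻¹ = 1 - 1 / (1 + t) := by field_simp; ring
          rw [this]; linarith
        have h4 : 0 < (1 - r)⁻¹ := inv_pos.mpr (by linarith)
        nlinarith
    _ = _ := by ring

lemma aux_row {n : ℕ} (P : Finset (Fin n → ℤ)) (p : Fin n → ℤ) (t : ℝ) (ht : 0 < t) :
    ∑ q ∈ P, Real.exp (-(t ^ 2 * ∑ i, ((p i : ℝ) - q i) ^ 2) / 2) ≤ (4 * (1 + 1 / t)) ^ n := by
  let T : Fin n → Finset ℤ := fun i => P.image fun q => p i - q i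
  have h1 := Finset.prod_univ_sum T
    (fun i m => Real.exp (-(t ^ 2 * (m : ℝ) ^ 2) / 2))
  calc _ = ∑ q ∈ P, ∏ i, Real.exp (-(t ^ 2 * (((p - q) i : ℤ) : ℝ) ^ 2) / 2) := by
        refine Finset.sum_congr rfl fun q _ => ?_
        rw [← Real.exp_sum]
        congr 1
        rw [← Finset.sum_div, Finset.sum_neg_distrib, Finset.mul_sum]
        simp
    _ = ∑ x ∈ P.image (fun q => p - q), ∏ i, Real.exp (-(t ^ 2 * ((x i : ℤ) : ℝ) ^ 2) / 2) := by
        rw [Finset.sum_image]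
        intro a _ b _ hab
        simpa using hab
    _ ≤ ∑ x ∈ Fintype.piFinset T, ∏ i, Real.exp (-(t ^ 2 * ((x i : ℤ) : ℝ) ^ 2) / 2) := by
        refine Finset.sum_le_sum_of_subset_of_nonneg ?_ fun _ _ _ => by positivity
        intro x hx
        obtain ⟨q, hq, rfl⟩ := Finset.mem_image.mp hx
        rw [Fintype.mem_piFinset]
        intro i
        exact Finset.mem_image.mpr ⟨q, hq, rfl⟩
    _ = _ := h1.symm
    _ ≤ ∏ i : Fin n, (4 * (1 + 1 / t)) :=
        Finset.prod_le_prod (fun _ _ => by positivity) fun i _ => aux_theta t ht _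
    _ = _ := by simp

/-- The exponential sum. -/
noncomputable def auxS {k n : ℕ} (P : Finset (Fin n → ℤ)) (A : Fin k × Fin n → ℝ)
    (ξ : Fin k → ℝ) : ℂ :=
  ∑ p ∈ P, Complex.exp (((∑ j, ξ j * ∑ i, A (j, i) * (p i : ℝ) : ℝ) : ℂ) * Complex.I)

lemma auxS_cont {k n : ℕ} (P : Finset (Fin n → ℤ)) :
    Continuous (fun x : (Fin k × Fin n → ℝ) × (Fin k → ℝ) => auxS P x.1 x.2) := by
  unfold auxS
  fun_prop

lemma auxS_norm_le {k n : ℕ} (P : Finset (Fin n → ℤ)) (A : Fin k × Fin n → ℝ) (ξ : Fin k → ℝ) :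
    ‖auxS P A ξ‖ ≤ P.card := by
  unfold auxS
  refine (norm_sum_le _ _).trans ?_
  simp only [Complex.norm_exp_ofReal_mul_I]
  simp

lemma auxS_sq {k n : ℕ} (P : Finset (Fin n → ℤ)) (A : Fin k × Fin n → ℝ) (ξ : Fin k → ℝ) :
    ((‖auxS P A ξ‖ ^ 2 : ℝ) : ℂ) = ∑ p ∈ P, ∑ q ∈ P,
      Complex.exp (((∑ x : Fin k × Fin n, (ξ x.1 * ((p x.2 : ℝ) - q x.2)) * A x : ℝ) : ℂ)
        * Complex.I) := by
  push_cast
  rw [← Complex.mul_conj']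
  unfold auxS
  rw [map_sum, Finset.sum_mul_sum]
  refine Finset.sum_congr rfl fun p _ => Finset.sum_congr rfl fun q _ => ?_
  rw [← Complex.exp_conj, ← Complex.exp_add]
  congr 1
  simp only [map_mul, Complex.conj_I, Complex.conj_ofReal]
  rw [mul_neg, ← sub_eq_add_neg, ← sub_mul]
  congr 1
  norm_cast
  rw [Fintype.sum_prod_type, ← Finset.sum_sub_distrib]
  push_cast
  refine Finset.sum_congr rfl fun j _ => ?_
  rw [← mul_sub, ← Finset.sum_sub_distrib, Finset.mul_sum]
  refine Finset.sum_congr rfl fun i _ => ?_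
  ring

lemma auxS_int_sq {k n : ℕ} (P : Finset (Fin n → ℤ)) (ξ : Fin k → ℝ) :
    ∫ A, ‖auxS P A ξ‖ ^ 2
      ∂(Measure.pi fun _ : Fin k × Fin n => ProbabilityTheory.gaussianReal 0 1) =
    ∑ p ∈ P, ∑ q ∈ P,
      Real.exp (-((∑ j, ξ j ^ 2) * ∑ i, ((p i : ℝ) - q i) ^ 2) / 2) := by
  apply Complex.ofReal_injective
  rw [← integral_complex_ofReal]
  simp_rw [auxS_sq]
  have hint : ∀ a : Fin k × Fin n → ℝ, Integrable
      (fun A : Fin k × Fin n → ℝ => Complex.exp (((∑ x, a x * A x : ℝ) : ℂ) * Complex.I))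
      (Measure.pi fun _ : Fin k × Fin n => ProbabilityTheory.gaussianReal 0 1) := by
    intro a
    refine Integrable.of_bound (C := 1) (Continuous.aestronglyMeasurable (by fun_prop)) ?_
    exact Filter.Eventually.of_forall fun A => (Complex.norm_exp_ofReal_mul_I _).le
  rw [integral_finsetSum _ fun p _ => integrable_finsetSum _ fun q _ => hint _]
  rw [Complex.ofReal_sum]
  refine Finset.sum_congr rfl fun p _ => ?_
  rw [integral_finsetSum _ fun q _ => hint _, Complex.ofReal_sum]
  refine Finset.sum_congr rfl fun q _ => ?_
  rw [aux_gchar]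
  congr 4
  rw [Fintype.sum_prod_type, Finset.sum_mul_sum]
  simp [mul_pow]

lemma auxS_int {k n : ℕ} (P : Finset (Fin n → ℤ)) (ξ : Fin k → ℝ) (l : ℝ) (hl : 0 < l)
    (h : ∑ p ∈ P, ∑ q ∈ P,
      Real.exp (-((∑ j, ξ j ^ 2) * ∑ i, ((p i : ℝ) - q i) ^ 2) / 2) ≤ l ^ 2) :
    ∫ A, ‖auxS P A ξ‖
      ∂(Measure.pi fun _ : Fin k × Fin n => ProbabilityTheory.gaussianReal 0 1) ≤ l := by
  set ν := (Measure.pi fun _ : Fin k × Fin n => ProbabilityTheory.gaussianReal 0 1)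
  have hc : Continuous fun A : Fin k × Fin n → ℝ => auxS P A ξ :=
    (auxS_cont P).comp (by fun_prop : Continuous fun A : Fin k × Fin n → ℝ => (A, ξ))
  have hi1 : Integrable (fun A => ‖auxS P A ξ‖) ν :=
    Integrable.of_bound (C := P.card) hc.norm.aestronglyMeasurable
      (Filter.Eventually.of_forall fun A => by simpa using auxS_norm_le P A ξ)
  have hi2 : Integrable (fun A => ‖auxS P A ξ‖ ^ 2) ν :=
    Integrable.of_bound (C := (P.card : ℝ) ^ 2) (hc.norm.pow 2).aestronglyMeasurable
      (Filter.Eventually.of_forall fun A => by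
        simpa using pow_le_pow_left₀ (norm_nonneg _) (auxS_norm_le P A ξ) 2)
  calc ∫ A, ‖auxS P A ξ‖ ∂ν ≤ ∫ A, (l / 2 + (1 / (2 * l)) * ‖auxS P A ξ‖ ^ 2) ∂ν := by
        refine integral_mono hi1 ((integrable_const _).add (hi2.const_mul _)) fun A => ?_
        have : l / 2 + (1 / (2 * l)) * ‖auxS P A ξ‖ ^ 2 - ‖auxS P A ξ‖
          = (1 / (2 * l)) * (l - ‖auxS P A ξ‖) ^ 2 := by field_simp; ring
        have h2 : 0 ≤ (1 / (2 * l)) * (l - ‖auxS P A ξ‖) ^ 2 := by positivity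
        simp only []
        linarith
    _ = l / 2 + (1 / (2 * l)) * ∫ A, ‖auxS P A ξ‖ ^ 2 ∂ν := by
        rw [integral_add (integrable_const _) (hi2.const_mul _), integral_const_mul]
        simp
    _ ≤ l / 2 + (1 / (2 * l)) * l ^ 2 := by
        rw [auxS_int_sq]
        gcongr
    _ = l := by field_simp; ring

lemma aux_g_le {k n : ℕ} (P : Finset (Fin n → ℤ)) (A : Fin k × Fin n → ℝ) (y : Fin k → ℝ) :
    ∑ p ∈ P, Real.exp (-(∑ j, ((∑ i, A (j, i) * (p i : ℝ)) - y j) ^ 2) / 2)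
    ≤ ∫ ξ, ‖auxS P A ξ‖ ∂(Measure.pi fun _ : Fin k => ProbabilityTheory.gaussianReal 0 1) := by
  set μ := (Measure.pi fun _ : Fin k => ProbabilityTheory.gaussianReal 0 1)
  have h1 : ((∑ p ∈ P, Real.exp (-(∑ j, ((∑ i, A (j, i) * (p i : ℝ)) - y j) ^ 2) / 2) : ℝ) : ℂ)
      = ∫ ξ : Fin k → ℝ, ∑ p ∈ P, Complex.exp
        (((∑ j, ((∑ i, A (j, i) * (p i : ℝ)) - y j) * ξ j : ℝ) : ℂ) * Complex.I) ∂μ := by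
    rw [integral_finsetSum]
    · rw [Complex.ofReal_sum]
      refine Finset.sum_congr rfl fun p _ => ?_
      rw [aux_gchar]
    · intro p _
      refine Integrable.of_bound (C := 1) (Continuous.aestronglyMeasurable (by fun_prop)) ?_
      exact Filter.Eventually.of_forall fun A => (Complex.norm_exp_ofReal_mul_I _).le
  have h2 : ∀ ξ : Fin k → ℝ, ‖∑ p ∈ P, Complex.exp
        (((∑ j, ((∑ i, A (j, i) * (p i : ℝ)) - y j) * ξ j : ℝ) : ℂ) * Complex.I)‖
      = ‖auxS P A ξ‖ := by
    intro ξ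
    have : ∑ p ∈ P, Complex.exp
        (((∑ j, ((∑ i, A (j, i) * (p i : ℝ)) - y j) * ξ j : ℝ) : ℂ) * Complex.I)
        = auxS P A ξ * Complex.exp (((-∑ j, y j * ξ j : ℝ) : ℂ) * Complex.I) := by
      unfold auxS
      rw [Finset.sum_mul]
      refine Finset.sum_congr rfl fun p _ => ?_
      rw [← Complex.exp_add, ← add_mul, ← Complex.ofReal_add]
      congr 3
      rw [← sub_eq_add_neg, ← Finset.sum_sub_distrib]
      refine Finset.sum_congr rfl fun j _ => ?_
      ring
    rw [this, norm_mul, Complex.norm_exp_ofReal_mul_I, mul_one]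
  calc _ ≤ ‖((∑ p ∈ P, Real.exp (-(∑ j, ((∑ i, A (j, i) * (p i : ℝ)) - y j) ^ 2) / 2) : ℝ) : ℂ)‖ := by
        rw [Complex.norm_real]; exact le_abs_self _
    _ ≤ _ := by
        rw [h1]
        refine (norm_integral_le_integral_norm _).trans_eq ?_
        simp_rw [h2]

lemma aux_Q {k n : ℕ} (hk : 1 ≤ k) (hn : 2 * k + 1 ≤ n) (P : Finset (Fin n → ℤ))
    (hP : P.Nonempty) (ξ : Fin k → ℝ) :
    ∑ p ∈ P, ∑ q ∈ P,
      Real.exp (-((∑ j, ξ j ^ 2) * ∑ i, ((p i : ℝ) - q i) ^ 2) / 2) ≤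
    ((4 : ℝ) ^ n * ((P.card : ℝ) *
      ∏ j, (1 + ‖(P.card : ℝ) ^ (1 / (n : ℝ)) * ξ j‖) ^ (-((n : ℝ) / (2 * k)))
      + (P.card : ℝ) ^ (1 / 2 : ℝ))) ^ 2 := by
  set N : ℝ := (P.card : ℝ) with hN
  have hN1 : 1 ≤ N := by
    rw [hN]; exact_mod_cast hP.card_pos
  have hn0 : (0 : ℝ) < n := by exact_mod_cast (by omega : 0 < n)
  have hk0 : (0 : ℝ) < k := by exact_mod_cast (by omega : 0 < k)
  set M : ℝ := N ^ (1 / (n : ℝ)) with hM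
  have hM0 : 0 < M := by positivity
  have hMn : M ^ n = N := by
    rw [hM, ← Real.rpow_natCast, ← Real.rpow_mul (by linarith), one_div,
      inv_mul_cancel₀ hn0.ne', Real.rpow_one]
  set t : ℝ := √(∑ j, ξ j ^ 2) with ht
  have ht0 : 0 ≤ t := Real.sqrt_nonneg _
  have hss : 0 ≤ ∑ j, ξ j ^ 2 := Finset.sum_nonneg fun j _ => sq_nonneg _
  have ht2 : ∑ j, ξ j ^ 2 = t ^ 2 := (Real.sq_sqrt hss).symm
  clear_value t M
  set D : ℝ := ∏ j, (1 + ‖M * ξ j‖) ^ (-((n : ℝ) / (2 * k))) with hD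
  have hDge : (1 + M * t) ^ (-((n : ℝ) / 2)) ≤ D := by
    have h1 : (1 + M * t) ^ (-((n : ℝ) / 2)) = ∏ j : Fin k, (1 + M * t) ^ (-((n : ℝ) / (2 * k))) := by
      rw [Finset.prod_const, Finset.card_univ, Fintype.card_fin, ← Real.rpow_natCast,
        ← Real.rpow_mul (by positivity)]
      congr 1
      field_simp
    rw [h1]
    refine Finset.prod_le_prod (fun _ _ => by positivity) fun j _ => ?_
    refine Real.rpow_le_rpow_of_nonpos (by positivity) ?_ (by
      rw [neg_nonpos]; positivity)
    rw [norm_mul, Real.norm_eq_abs, Real.norm_eq_abs, abs_of_pos hM0]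
    gcongr
    rw [ht]
    apply Real.le_sqrt_of_sq_le
    rw [sq_abs]
    exact Finset.single_le_sum (f := fun j => ξ j ^ 2) (fun j _ => sq_nonneg _) (Finset.mem_univ j)
  have hD0 : 0 ≤ D := le_trans (by positivity) hDge
  clear_value D
  clear hD ht hM
  have hD2 : ((1 + M * t) ^ n)⁻¹ ≤ D ^ 2 := by
    have h1 : ((1 + M * t) ^ n)⁻¹ = ((1 + M * t) ^ (-((n : ℝ) / 2))) ^ 2 := by
      rw [← Real.rpow_natCast (_ ^ _) 2, ← Real.rpow_mul (by positivity), ← Real.rpow_natCast,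
        ← Real.rpow_neg (by positivity)]
      congr 1
      push_cast
      ring
    rw [h1]
    exact pow_le_pow_left₀ (by positivity) hDge 2
  have hhalf : (N ^ (1 / 2 : ℝ)) ^ 2 = N := by
    rw [← Real.rpow_natCast, ← Real.rpow_mul (by linarith)]
    norm_num
  have hhalf0 : 0 ≤ N ^ (1 / 2 : ℝ) := by positivity
  have hl : (16 : ℝ) ^ n * (N ^ 2 * D ^ 2 + N) ≤ ((4 : ℝ) ^ n * (N * D + N ^ (1 / 2 : ℝ))) ^ 2 := by
    rw [mul_pow, ← pow_mul, mul_comm n 2, pow_mul]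
    norm_num only
    gcongr
    have : 0 ≤ N * D * N ^ (1 / 2 : ℝ) := by positivity
    nlinarith
  refine le_trans ?_ hl
  rw [ht2]
  have hQ1 : ∑ p ∈ P, ∑ q ∈ P, Real.exp (-(t ^ 2 * ∑ i, ((p i : ℝ) - q i) ^ 2) / 2) ≤ N ^ 2 := by
    calc _ ≤ ∑ p ∈ P, ∑ q ∈ P, (1 : ℝ) := by
          refine Finset.sum_le_sum fun p _ => Finset.sum_le_sum fun q _ => ?_
          rw [Real.exp_le_one_iff]
          have : 0 ≤ t ^ 2 * ∑ i, ((p i : ℝ) - q i) ^ 2 :=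
            mul_nonneg (sq_nonneg _) (Finset.sum_nonneg fun i _ => sq_nonneg _)
          linarith
      _ = N ^ 2 := by simp [hN, sq]
  by_cases hc : M * t ≤ 1
  · refine hQ1.trans ?_
    have h1 : ((2 : ℝ) ^ n)⁻¹ ≤ D ^ 2 := by
      refine le_trans ?_ hD2
      gcongr
      linarith
    have h2 : (1 : ℝ) ≤ 16 ^ n * D ^ 2 := by
      calc (1 : ℝ) ≤ 8 ^ n := one_le_pow₀ (by norm_num)
        _ = 16 ^ n * ((2 : ℝ) ^ n)⁻¹ := by
            rw [← inv_pow, ← mul_pow]; norm_num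
        _ ≤ _ := by gcongr
    have h3 : (0 : ℝ) ≤ 16 ^ n * N := by positivity
    nlinarith [sq_nonneg N]
  · push Not at hc
    have htp : 0 < t := by
      by_contra h
      have : t = 0 := le_antisymm (not_lt.mp h) ht0
      rw [this] at hc
      norm_num at hc
    have hQ2 : ∑ p ∈ P, ∑ q ∈ P, Real.exp (-(t ^ 2 * ∑ i, ((p i : ℝ) - q i) ^ 2) / 2)
        ≤ N * (4 * (1 + 1 / t)) ^ n := by
      calc _ ≤ ∑ p ∈ P, (4 * (1 + 1 / t)) ^ n :=
            Finset.sum_le_sum fun p _ => aux_row P p t htp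
        _ = _ := by simp [hN]
    refine hQ2.trans ?_
    by_cases ht1 : t ≤ 1
    · have h1 : 4 * (1 + 1 / t) ≤ 8 / t := by
        have : 1 ≤ 1 / t := by rw [le_div_iff₀ htp]; linarith
        have h8 : 8 / t = 8 * (1 / t) := by ring
        rw [h8]; linarith
      have h2 : ((2 * (M * t)) ^ n)⁻¹ ≤ D ^ 2 := by
        refine le_trans ?_ hD2
        gcongr
        linarith
      have h3 : N * (8 / t) ^ n = 16 ^ n * (N ^ 2 * ((2 * (M * t)) ^ n)⁻¹) := by
        rw [mul_pow, mul_pow, hMn, div_pow]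
        have : (16 : ℝ) ^ n = 8 ^ n * 2 ^ n := by rw [← mul_pow]; norm_num
        rw [this]
        field_simp
      calc N * (4 * (1 + 1 / t)) ^ n ≤ N * (8 / t) ^ n := by gcongr
        _ = _ := h3
        _ ≤ 16 ^ n * (N ^ 2 * D ^ 2 + N) := by
            gcongr
            have : N ^ 2 * ((2 * (M * t)) ^ n)⁻¹ ≤ N ^ 2 * D ^ 2 := by gcongr
            linarith
    · push Not at ht1
      have h1 : 4 * (1 + 1 / t) ≤ 16 := by
        have : 1 / t ≤ 1 := by rw [div_le_iff₀ htp]; linarith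
        linarith
      calc N * (4 * (1 + 1 / t)) ^ n ≤ N * 16 ^ n := by gcongr
        _ ≤ 16 ^ n * (N ^ 2 * D ^ 2 + N) := by
          rw [mul_comm]
          gcongr
          have : 0 ≤ N ^ 2 * D ^ 2 := by positivity
          linarith

lemma aux_core (k n : ℕ) (hk : 1 ≤ k) (hn : 2 * k + 1 ≤ n) :
    ∃ C B : ℝ, 0 < C ∧ ∀ P : Finset (Fin n → ℤ), P.Nonempty →
      ∃ A : Fin k × Fin n → ℝ, ∑ x, A x ^ 2 ≤ B ∧ ∀ y : Fin k → ℝ,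
        ∑ p ∈ P, Real.exp (-(∑ j, ((∑ i, A (j, i) * (p i : ℝ)) - y j) ^ 2) / 2)
          ≤ C * (P.card : ℝ) ^ (((n : ℝ) - k) / n) := by
  have hn0 : (0 : ℝ) < n := by exact_mod_cast (by omega : 0 < n)
  have hk0 : (0 : ℝ) < k := by exact_mod_cast (by omega : 0 < k)
  have hkn : (2 : ℝ) * k + 1 ≤ n := by exact_mod_cast hn
  set α : ℝ := (n : ℝ) / (2 * k) with hα
  have hα1 : 1 < α := by rw [hα, lt_div_iff₀ (by positivity)]; linarith
  have hJi : Integrable (fun x : ℝ => (1 + ‖x‖) ^ (-α)) :=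
    integrable_one_add_norm (by simpa using hα1)
  set J : ℝ := ∫ x : ℝ, (1 + ‖x‖) ^ (-α) with hJ
  have hJ0 : 0 ≤ J := integral_nonneg fun x => by positivity
  set ν := (Measure.pi fun _ : Fin k × Fin n => ProbabilityTheory.gaussianReal 0 1) with hν
  set μ := (Measure.pi fun _ : Fin k => ProbabilityTheory.gaussianReal 0 1) with hμ
  set B : ℝ := ∫ A : Fin k × Fin n → ℝ, ∑ x, A x ^ 2 ∂ν with hB
  have hBi : Integrable (fun A : Fin k × Fin n → ℝ => ∑ x, A x ^ 2) ν := by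
    refine integrable_finsetSum _ fun x _ => ?_
    refine integrable_comp_eval (X := fun _ => ℝ) (i := x) (f := fun z : ℝ => z ^ 2) ?_
    have := (ProbabilityTheory.memLp_id_gaussianReal (μ := 0) (v := 1) 2)
    exact this.integrable_sq
  have hB0 : 0 ≤ B := integral_nonneg fun A => Finset.sum_nonneg fun x _ => sq_nonneg _
  set K0 : ℝ := 4 ^ n * (J ^ k + 1) with hK0
  have hK0p : 0 < K0 := by positivity
  refine ⟨(1 + B) * K0, 1 + B, by positivity, fun P hP => ?_⟩
  have hN1 : 1 ≤ (P.card : ℝ) := by exact_mod_cast hP.card_pos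
  set N : ℝ := (P.card : ℝ) with hN
  have hN0 : 0 < N := by linarith
  set M : ℝ := N ^ (1 / (n : ℝ)) with hM
  have hM0 : 0 < M := by positivity
  set e : ℝ := ((n : ℝ) - k) / n with he
  set l : (Fin k → ℝ) → ℝ := fun ξ => (4 : ℝ) ^ n * (N *
      ∏ j, (1 + ‖M * ξ j‖) ^ (-α) + N ^ (1 / 2 : ℝ)) with hl
  have hl0 : ∀ ξ, 0 < l ξ := fun ξ => by
    have : 0 ≤ ∏ j, (1 + ‖M * ξ j‖) ^ (-α) := Finset.prod_nonneg fun j _ => by positivity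
    simp only [hl]
    positivity
  have hfi : Integrable (fun x : ℝ => (1 + ‖M * x‖) ^ (-α)) :=
    (integrable_comp_mul_left_iff (fun x : ℝ => (1 + ‖x‖) ^ (-α)) hM0.ne').mpr hJi
  have hfc : Continuous (fun x : ℝ => (1 + ‖M * x‖) ^ (-α)) := by
    refine Continuous.rpow_const (by fun_prop) fun x => Or.inl ?_
    positivity
  have hfg : Integrable (fun x : ℝ => (1 + ‖M * x‖) ^ (-α)) (ProbabilityTheory.gaussianReal 0 1) := by
    refine Integrable.of_bound (C := 1) hfc.aestronglyMeasurable
      (Filter.Eventually.of_forall fun x => ?_)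
    rw [Real.norm_of_nonneg (by positivity)]
    refine Real.rpow_le_one_of_one_le_of_nonpos ?_ (by linarith)
    linarith [norm_nonneg (M * x)]
  have hpi : Integrable (fun ξ : Fin k → ℝ => ∏ j, (1 + ‖M * ξ j‖) ^ (-α)) μ :=
    Integrable.fintype_prod (f := fun _ x => (1 + ‖M * x‖) ^ (-α)) fun _ => hfg
  have hli : Integrable l μ := ((hpi.const_mul N).add (integrable_const _)).const_mul _
  have hf1 : ∫ x : ℝ, (1 + ‖M * x‖) ^ (-α) ∂(ProbabilityTheory.gaussianReal 0 1) ≤ M⁻¹ * J := by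
    refine (aux_gdom _ (fun x => by positivity) hfi).trans_eq ?_
    rw [Measure.integral_comp_mul_left (fun x : ℝ => (1 + ‖x‖) ^ (-α)) M, abs_of_pos (by positivity),
      smul_eq_mul]
  have hlint : ∫ ξ, l ξ ∂μ ≤ K0 * N ^ e := by
    have h1 : ∫ ξ, l ξ ∂μ = 4 ^ n * (N *
        (∫ x : ℝ, (1 + ‖M * x‖) ^ (-α) ∂(ProbabilityTheory.gaussianReal 0 1)) ^ k
        + N ^ (1 / 2 : ℝ)) := by
      simp only [hl]
      rw [integral_const_mul, integral_add (hpi.const_mul N) (integrable_const _),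
        integral_const_mul, hμ,
        integral_fintype_prod_eq_pow (fun x : ℝ => (1 + ‖M * x‖) ^ (-α))]
      simp
    rw [h1]
    have h2 : N * (M⁻¹ * J) ^ k = J ^ k * N ^ e := by
      have : N ^ e = N * (M⁻¹) ^ k := by
        rw [hM, ← Real.rpow_neg hN0.le, ← Real.rpow_natCast, ← Real.rpow_mul hN0.le]
        nth_rewrite 2 [← Real.rpow_one N]
        rw [← Real.rpow_add hN0, he]
        congr 1
        field_simp
        ring
      rw [this, mul_pow]
      ring
    have h3 : N ^ (1 / 2 : ℝ) ≤ N ^ e := by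
      refine Real.rpow_le_rpow_of_exponent_le hN1 ?_
      rw [he, div_le_div_iff₀ (by norm_num) hn0]
      linarith
    have h4 : 0 ≤ ∫ x : ℝ, (1 + ‖M * x‖) ^ (-α) ∂(ProbabilityTheory.gaussianReal 0 1) :=
      integral_nonneg fun x => by positivity
    calc _ ≤ 4 ^ n * (N * (M⁻¹ * J) ^ k + N ^ e) := by gcongr
      _ = _ := by rw [h2, hK0]; ring
  -- Fubini
  have hSi : Integrable (uncurry fun (A : Fin k × Fin n → ℝ) (ξ : Fin k → ℝ) => ‖auxS P A ξ‖)
      (ν.prod μ) := by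
    refine Integrable.of_bound (C := N) (auxS_cont P).norm.aestronglyMeasurable
      (Filter.Eventually.of_forall fun x => ?_)
    simpa [uncurry] using auxS_norm_le P x.1 x.2
  have hG : ∫ A, ∫ ξ, ‖auxS P A ξ‖ ∂μ ∂ν ≤ K0 * N ^ e := by
    rw [integral_integral_swap hSi]
    refine le_trans ?_ hlint
    refine integral_mono hSi.swap.integral_prod_left hli fun ξ => ?_
    exact auxS_int P ξ (l ξ) (hl0 ξ) (aux_Q hk hn P hP ξ)
  have hGi : Integrable (fun A => ∫ ξ, ‖auxS P A ξ‖ ∂μ) ν := hSi.integral_prod_left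
  have hK : 0 < K0 * N ^ e := by positivity
  obtain ⟨A, hA⟩ := exists_le_integral
    ((hGi.const_mul (K0 * N ^ e)⁻¹).add hBi)
  rw [integral_add' (hGi.const_mul _) hBi, integral_const_mul] at hA
  simp only [Pi.add_apply] at hA
  have h5 : (K0 * N ^ e)⁻¹ * ∫ A, ∫ ξ, ‖auxS P A ξ‖ ∂μ ∂ν ≤ 1 := by
    rw [inv_mul_le_iff₀ hK]; linarith
  have h6 : 0 ≤ (K0 * N ^ e)⁻¹ * ∫ ξ, ‖auxS P A ξ‖ ∂μ :=
    mul_nonneg (by positivity) (integral_nonneg fun _ => norm_nonneg _)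
  have h7 : 0 ≤ ∑ x, A x ^ 2 := Finset.sum_nonneg fun x _ => sq_nonneg _
  refine ⟨A, by linarith, fun y => (aux_g_le P A y).trans ?_⟩
  have h8 : (K0 * N ^ e)⁻¹ * ∫ ξ, ‖auxS P A ξ‖ ∂μ ≤ 1 + B := by linarith
  rw [inv_mul_le_iff₀ hK] at h8
  linarith

/-- The grid cell of a point. -/
noncomputable def auxCell {n : ℕ} (x : EuclideanSpace ℝ (Fin n)) : Fin n → ℤ :=
  fun i => ⌊x i * ((n : ℝ) + 1)⌋

lemma auxCell_dist {n : ℕ} (x y : EuclideanSpace ℝ (Fin n)) (h : auxCell x = auxCell y) :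
    dist x y < 1 := by
  rw [EuclideanSpace.dist_eq, Real.sqrt_lt' one_pos]
  have hn : (0 : ℝ) ≤ n := Nat.cast_nonneg n
  have h1 : ∀ i, dist (x i) (y i) ^ 2 ≤ (1 / ((n : ℝ) + 1)) ^ 2 := by
    intro i
    have h2 := Int.abs_sub_lt_one_of_floor_eq_floor (congrFun h i)
    rw [← sub_mul, abs_mul, abs_of_pos (by positivity : (0 : ℝ) < n + 1)] at h2
    rw [Real.dist_eq]
    refine pow_le_pow_left₀ (abs_nonneg _) ?_ 2
    rw [le_div_iff₀ (by positivity)]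
    exact h2.le
  calc _ ≤ ∑ i : Fin n, (1 / ((n : ℝ) + 1)) ^ 2 := Finset.sum_le_sum fun i _ => h1 i
    _ = n * (1 / ((n : ℝ) + 1)) ^ 2 := by simp
    _ < 1 ^ 2 := by
      rw [div_pow, one_pow, mul_one_div, div_lt_iff₀ (by positivity)]
      nlinarith

lemma auxCell_eq {n : ℕ} (p : Fin n → ℤ) :
    {x : EuclideanSpace ℝ (Fin n) | auxCell x = p} =
    (MeasurableEquiv.toLp 2 (Fin n → ℝ)).symm ⁻¹' (Set.pi univ fun i =>
      Ico ((p i : ℝ) / (n + 1)) (((p i : ℝ) + 1) / (n + 1))) := by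
  ext x
  have hn : (0 : ℝ) < (n : ℝ) + 1 := by positivity
  simp only [mem_ofPred_eq, mem_preimage, mem_pi, mem_univ, true_imp_iff, mem_Ico]
  rw [funext_iff]
  refine forall_congr' fun i => ?_
  rw [div_le_iff₀ hn, lt_div_iff₀ hn]
  exact Int.floor_eq_iff

lemma auxCell_vol {n : ℕ} (p : Fin n → ℤ) :
    volume {x : EuclideanSpace ℝ (Fin n) | auxCell x = p} =
      ENNReal.ofReal ((((n : ℝ) + 1) ^ n)⁻¹) := by
  rw [auxCell_eq, (EuclideanSpace.volume_preserving_symm_measurableEquiv_toLp (Fin n)).measure_preimage_equiv,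
    Real.volume_pi_Ico]
  have : ∀ i, ((p i : ℝ) + 1) / (n + 1) - (p i : ℝ) / (n + 1) = ((n : ℝ) + 1)⁻¹ := by
    intro i
    field_simp
    ring
  simp_rw [this]
  rw [Finset.prod_const, ← ENNReal.ofReal_pow (by positivity), inv_pow]
  simp

lemma auxCell_meas {n : ℕ} (p : Fin n → ℤ) :
    MeasurableSet {x : EuclideanSpace ℝ (Fin n) | auxCell x = p} := by
  rw [auxCell_eq]
  exact (MeasurableEquiv.measurable _) (MeasurableSet.univ_pi fun i => (measurableSet_Ico : MeasurableSet (Ico ((p i : ℝ) / (n + 1)) _)))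

lemma aux_vol {n : ℕ} (S : Set (EuclideanSpace ℝ (Fin n))) (P : Finset (Fin n → ℤ))
    (h : ∀ p ∈ P, ∃ x ∈ S, auxCell x = p) :
    ENNReal.ofReal ((((n : ℝ) + 1) ^ n)⁻¹ * P.card) ≤ volume (Metric.thickening 1 S) := by
  calc _ = ∑ p ∈ P, volume {x : EuclideanSpace ℝ (Fin n) | auxCell x = p} := by
        simp_rw [auxCell_vol]
        rw [Finset.sum_const, nsmul_eq_mul, mul_comm, ENNReal.ofReal_mul (by positivity),
          ENNReal.ofReal_natCast]
    _ = volume (⋃ p ∈ P, {x : EuclideanSpace ℝ (Fin n) | auxCell x = p}) := by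
        refine (measure_biUnion_finset ?_ fun p _ => auxCell_meas p).symm
        intro p _ q _ hpq
        rw [Function.onFun, Set.disjoint_left]
        intro x hx hx'
        exact hpq (hx.symm.trans hx')
    _ ≤ _ := by
        refine measure_mono ?_
        intro x hx
        simp only [mem_iUnion, mem_ofPred_eq, exists_prop] at hx
        obtain ⟨p, hp, hxp⟩ := hx
        obtain ⟨z, hz, hzp⟩ := h p hp
        rw [Metric.mem_thickening_iff]
        exact ⟨z, hz, auxCell_dist _ _ (hxp.trans hzp.symm)⟩

lemma aux_count {E : Type} [NormedAddCommGroup E] [NormedSpace ℝ E]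
    (X : Geometry.SimplicialComplex ℝ E) (k L : ℕ) (hfin : X.faces.Finite)
    (hL : ∀ v ∈ X.vertices, {s | s ∈ X.faces ∧ s.card = k + 1 ∧ v ∈ s}.ncard ≤ L)
    (U : Finset (Finset E)) (hU : ∀ s ∈ U, s ∈ X.faces ∧ s.card = k + 1)
    (hd : ∀ s ∈ U, ∀ t ∈ U, ¬ Disjoint s t) : U.card ≤ (k + 1) * L := by
  rcases U.eq_empty_or_nonempty with rfl | ⟨s0, hs0⟩
  · simp
  have hf : ∀ v : E, {s | s ∈ X.faces ∧ s.card = k + 1 ∧ v ∈ s}.Finite := fun v =>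
    hfin.subset fun s hs => hs.1
  have hsub : U ⊆ s0.biUnion fun v => (hf v).toFinset := by
    intro s hs
    obtain ⟨v, hv1, hv2⟩ := Finset.not_disjoint_iff.mp (hd s0 hs0 s hs)
    rw [Finset.mem_biUnion]
    refine ⟨v, hv1, ?_⟩
    rw [Set.Finite.mem_toFinset]
    exact ⟨(hU s hs).1, (hU s hs).2, hv2⟩
  refine (Finset.card_le_card hsub).trans ?_
  refine (Finset.card_biUnion_le_card_mul s0 (fun v => (hf v).toFinset) L fun v hv => ?_).trans_eq
    (by rw [(hU s0 hs0).2])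
  rw [← Set.ncard_eq_toFinset_card _ (hf v)]
  refine hL v ?_
  exact X.down_closed (hU s0 hs0).1 (Finset.singleton_subset_iff.mpr hv) (Finset.singleton_nonempty v)

/-- Let `k ≥ 1` and `n ≥ 2k+1`.  There is `c(k, n) > 0` such that if a
finite `k`-dimensional complex `X`, in which every vertex lies in at most `L`
`k`-dimensional faces, has combinatorial width at least `W` over `ℝᵏ`, then for any
topological embedding of `|X|` into `ℝⁿ` with combinatorial thickness at least `1` the
Lebesgue measure of the open `1`-neighborhood of the image is at least
`c(k, n) * (W / L)^(n/(n-k))`. -/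
theorem statement7 (k n : ℕ) (hk : 1 ≤ k) (hn : 2 * k + 1 ≤ n) :
    ∃ c : ℝ, 0 < c ∧
      ∀ (E : Type) [NormedAddCommGroup E] [NormedSpace ℝ E]
        (X : Geometry.SimplicialComplex ℝ E) (L W : ℕ),
        X.faces.Finite →
        (∀ s ∈ X.faces, s.card ≤ k + 1) →
        (∀ v ∈ X.vertices, {s | s ∈ X.faces ∧ s.card = k + 1 ∧ v ∈ s}.ncard ≤ L) →
        HasCombWidthGE X k W →
        ∀ I : X.space → EuclideanSpace ℝ (Fin n),
          Continuous I → Function.Injective I → HasCombThickness X I 1 →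
          ENNReal.ofReal (c * ((W : ℝ) / (L : ℝ)) ^ ((n : ℝ) / ((n : ℝ) - (k : ℝ)))) ≤
            volume (Metric.thickening 1 (Set.range I)) := by
  have hn0 : (0 : ℝ) < n := by exact_mod_cast (by omega : 0 < n)
  have hk0 : (0 : ℝ) < k := by exact_mod_cast (by omega : 0 < k)
  have hkn : (2 : ℝ) * k + 1 ≤ n := by exact_mod_cast hn
  have hnk : (0 : ℝ) < n - k := by linarith
  obtain ⟨C, B, hC, hcore⟩ := aux_core k n hk hn
  set C2 : ℝ := (k + 1) * Real.exp (n * B / 2) * C with hC2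
  have hC2p : 0 < C2 := by positivity
  set r : ℝ := (n : ℝ) / ((n : ℝ) - (k : ℝ)) with hr
  have hrp : 0 < r := by positivity
  refine ⟨(((n : ℝ) + 1) ^ n)⁻¹ * (C2 ^ r)⁻¹, by positivity, ?_⟩
  intro E _ _ X L W hfin _ hL hW I hI _ hT
  by_cases hz : L = 0 ∨ W = 0
  · have : (W : ℝ) / (L : ℝ) = 0 := by
      rcases hz with h | h <;> simp [h]
    rw [this, Real.zero_rpow hrp.ne']
    simp
  push Not at hz
  obtain ⟨hL0, hW0⟩ := hz
  have hcomp : IsCompact X.space := by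
    unfold Geometry.SimplicialComplex.space
    exact hfin.isCompact_biUnion fun s _ => s.finite_toSet.isCompact_convexHull ℝ
  have : CompactSpace X.space := isCompact_iff_compactSpace.mp hcomp
  obtain ⟨R, hR⟩ := (isCompact_range hI).isBounded.exists_norm_le
  have hPfin : (Set.range fun x => auxCell (I x)).Finite := by
    refine (Set.finite_Icc (fun _ : Fin n => ⌊-R * ((n : ℝ) + 1)⌋)
      (fun _ : Fin n => ⌊R * ((n : ℝ) + 1)⌋)).subset ?_
    rintro _ ⟨x, rfl⟩
    have h1 : ∀ i, |I x i| ≤ R := fun i =>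
      (PiLp.norm_apply_le (I x) i).trans (hR _ ⟨x, rfl⟩)
    refine ⟨fun i => ?_, fun i => ?_⟩
    · refine Int.floor_le_floor ?_
      have := (abs_le.mp (h1 i)).1
      gcongr
    · refine Int.floor_le_floor ?_
      have := (abs_le.mp (h1 i)).2
      gcongr
  set P : Finset (Fin n → ℤ) := hPfin.toFinset with hP
  have hPmem : ∀ x, auxCell (I x) ∈ P := fun x => by
    rw [hP, Set.Finite.mem_toFinset]; exact ⟨x, rfl⟩
  have hPne : P.Nonempty := by
    obtain ⟨y, hy⟩ := hW (fun _ => 0) continuous_const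
    obtain ⟨s, -, -, x, -, -⟩ := Set.nonempty_of_ncard_ne_zero
      (ne_of_gt (lt_of_lt_of_le (Nat.pos_of_ne_zero hW0) hy))
    exact ⟨_, hPmem x⟩
  have hvol := aux_vol (Set.range I) P (by
    intro p hp
    rw [hP, Set.Finite.mem_toFinset] at hp
    obtain ⟨x, hx⟩ := hp
    exact ⟨I x, ⟨x, rfl⟩, hx⟩)
  refine le_trans (ENNReal.ofReal_le_ofReal ?_) hvol
  rw [mul_assoc]
  refine mul_le_mul_of_nonneg_left ?_ (by positivity)
  rw [inv_mul_le_iff₀ (by positivity)]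
  obtain ⟨A, hAB, hA⟩ := hcore P hPne
  have hN1 : 1 ≤ (P.card : ℝ) := by exact_mod_cast hPne.card_pos
  set N : ℝ := (P.card : ℝ) with hN
  -- the projection
  set F : X.space → EuclideanSpace ℝ (Fin k) := fun x =>
    WithLp.toLp 2 (fun j => ∑ i, A (j, i) * (I x i * ((n : ℝ) + 1))) with hF
  have hFc : Continuous F := by
    simp only [hF]
    fun_prop
  obtain ⟨y, hy⟩ := hW F hFc
  set T : Set (Finset E) := {s : Finset E | s ∈ X.faces ∧ s.card = k + 1 ∧
        ∃ x : X.space, F x = y ∧ (x : E) ∈ convexHull ℝ (s : Set E)} with hTdef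
  have hTfin : T.Finite := hfin.subset fun s hs => hs.1
  have : Nonempty X.space := by
    obtain ⟨p, hp⟩ := hPne
    rw [hP, Set.Finite.mem_toFinset] at hp
    exact ⟨hp.choose⟩
  have hTw : ∀ s : Finset E, s ∈ T →
      ∃ x : X.space, F x = y ∧ (x : E) ∈ convexHull ℝ (s : Set E) := fun s hs => hs.2.2
  choose! w hwF hwm using hTw
  set P' : Finset (Fin n → ℤ) := P.filter fun p => ∃ x, F x = y ∧ auxCell (I x) = p with hP'
  have hcount : T.ncard ≤ ((k + 1) * L) * P'.card := by
    rw [Set.ncard_eq_toFinset_card T hTfin]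
    refine Finset.card_le_mul_card_image_of_maps_to
      (f := fun s => auxCell (I (w s))) ?_ _ ?_
    · intro s hs
      rw [Set.Finite.mem_toFinset] at hs
      exact Finset.mem_filter.mpr ⟨hPmem _, w s, hwF s hs, rfl⟩
    · intro p _
      refine aux_count X k L hfin hL _ ?_ ?_
      · intro s hs
        have hs' := (Set.Finite.mem_toFinset hTfin).mp (Finset.mem_filter.mp hs).1
        exact ⟨hs'.1, hs'.2.1⟩
      · intro s hs t ht hst
        have hs' := (Set.Finite.mem_toFinset hTfin).mp (Finset.mem_filter.mp hs).1
        have ht' := (Set.Finite.mem_toFinset hTfin).mp (Finset.mem_filter.mp ht).1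
        have h1 := hT s hs'.1 t ht'.1 hst (w s) (w t) (hwm s hs') (hwm t ht')
        have h2 := auxCell_dist (I (w s)) (I (w t))
          ((Finset.mem_filter.mp hs).2.trans (Finset.mem_filter.mp ht).2.symm)
        linarith
  have hexp : ∀ p ∈ P', Real.exp (-(n * B / 2)) ≤
      Real.exp (-(∑ j, ((∑ i, A (j, i) * (p i : ℝ)) - y j) ^ 2) / 2) := by
    intro p hp
    obtain ⟨x, hxy, hxp⟩ := (Finset.mem_filter.mp hp).2
    rw [Real.exp_le_exp]
    have h1 : ∀ j, ((∑ i, A (j, i) * (p i : ℝ)) - y j) ^ 2 ≤ (∑ i, A (j, i) ^ 2) * n := by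
      intro j
      have hyj : y j = ∑ i, A (j, i) * (I x i * ((n : ℝ) + 1)) := by
        rw [← hxy]
      rw [hyj, ← Finset.sum_sub_distrib]
      simp_rw [← mul_sub]
      refine (Finset.sum_mul_sq_le_sq_mul_sq _ _ _).trans ?_
      refine mul_le_mul_of_nonneg_left ?_ (Finset.sum_nonneg fun i _ => sq_nonneg _)
      calc _ ≤ ∑ i : Fin n, (1 : ℝ) := by
            refine Finset.sum_le_sum fun i _ => ?_
            have hpi : p i = ⌊I x i * ((n : ℝ) + 1)⌋ := by rw [← hxp]; rfl
            have ha := Int.floor_le (I x i * ((n : ℝ) + 1))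
            have hb := Int.lt_floor_add_one (I x i * ((n : ℝ) + 1))
            rw [← hpi] at ha hb
            nlinarith
        _ = n := by simp
    have h2 : ∑ j, ((∑ i, A (j, i) * (p i : ℝ)) - y j) ^ 2 ≤ n * B := by
      calc _ ≤ ∑ j, (∑ i, A (j, i) ^ 2) * (n : ℝ) := Finset.sum_le_sum fun j _ => h1 j
        _ = (∑ x, A x ^ 2) * n := by rw [Fintype.sum_prod_type, Finset.sum_mul]
        _ ≤ B * n := by gcongr
        _ = _ := mul_comm _ _
    linarith
  set e : ℝ := ((n : ℝ) - k) / n with he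
  have hP'c : (P'.card : ℝ) ≤ Real.exp (n * B / 2) * (C * N ^ e) := by
    have h1 : (P'.card : ℝ) * Real.exp (-(n * B / 2)) ≤ C * N ^ e := by
      refine le_trans ?_ (hA (fun j => y j))
      calc (P'.card : ℝ) * Real.exp (-(n * B / 2)) = ∑ p ∈ P', Real.exp (-(n * B / 2)) := by simp
        _ ≤ ∑ p ∈ P', Real.exp (-(∑ j, ((∑ i, A (j, i) * (p i : ℝ)) - y j) ^ 2) / 2) :=
            Finset.sum_le_sum hexp
        _ ≤ _ := Finset.sum_le_sum_of_subset_of_nonneg (Finset.filter_subset _ _)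
            fun _ _ _ => (Real.exp_pos _).le
    rw [Real.exp_neg, ← div_eq_mul_inv, div_le_iff₀ (Real.exp_pos _)] at h1
    linarith
  have hLp : (0 : ℝ) < L := by exact_mod_cast Nat.pos_of_ne_zero hL0
  have hWL : (W : ℝ) / L ≤ C2 * N ^ e := by
    rw [div_le_iff₀ hLp]
    have h1 : (W : ℝ) ≤ ((k + 1) * L) * P'.card := by exact_mod_cast hy.trans hcount
    calc (W : ℝ) ≤ ((k + 1) * L) * P'.card := h1
      _ ≤ ((k + 1) * L) * (Real.exp (n * B / 2) * (C * N ^ e)) := by gcongr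
      _ = _ := by rw [hC2]; ring
  calc ((W : ℝ) / L) ^ r ≤ (C2 * N ^ e) ^ r :=
        Real.rpow_le_rpow (by positivity) hWL hrp.le
    _ = C2 ^ r * N := by
        rw [Real.mul_rpow hC2p.le (by positivity), ← Real.rpow_mul (by linarith)]
        have : e * r = 1 := by rw [he, hr]; field_simp
        rw [this, Real.rpow_one]
end

section
/- Fix integers D > k ≥ 1. There is a constant c(D,k) > 0 with the following property: for every integer S ≥ 1 and every continuous map F : X^{k,D}(S) → ℝ^k, there exists y ∈ ℝ^k such that the fiber F⁻¹(y) intersects at least c(D,k)·S^{D−k} distinct k-dimensional faces of X^{k,D}(S). -/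
open scoped Classical
open Metric Set Function

/-- The face of the unit cubical grid in `ℝᴰ` determined by the set `w` of interval
coordinates and the integer corner `a`: in coordinates `i ∈ w` the points range over
`[a i, a i + 1]`, and in the remaining coordinates they are equal to `a i`. -/
def gridFace (D : ℕ) (w : Finset (Fin D)) (a : Fin D → ℕ) :
    Set (EuclideanSpace ℝ (Fin D)) :=
  {x | ∀ i : Fin D, (i ∈ w → x i ∈ Set.Icc (a i : ℝ) ((a i : ℝ) + 1)) ∧
    (i ∉ w → x i = (a i : ℝ))}

/-- `f` is a `j`-dimensional face of the unit cubical grid on the cube `[0, S]^D`. -/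
def IsGridFace (j D S : ℕ) (f : Set (EuclideanSpace ℝ (Fin D))) : Prop :=
  ∃ w : Finset (Fin D), w.card = j ∧ ∃ a : Fin D → ℕ,
    (∀ i ∈ w, a i + 1 ≤ S) ∧ (∀ i : Fin D, i ∉ w → a i ≤ S) ∧ f = gridFace D w a

/-- `X^{k,D}(S)` : the `k`-skeleton of the unit cubical grid on the cube `[0, S]^D`,
i.e. the union of all grid faces of dimension at most `k`. -/
def gridSkeleton (k D S : ℕ) : Set (EuclideanSpace ℝ (Fin D)) :=
  {x | ∃ j : ℕ, j ≤ k ∧ ∃ f : Set (EuclideanSpace ℝ (Fin D)), IsGridFace j D S f ∧ x ∈ f}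

abbrev Coch (D : ℕ) := Finset (Fin D) → (Fin D → ℕ) → ZMod 2

namespace Coch
variable {D : ℕ}

lemma z2 (x : ZMod 2) : x + x = 0 := CharTwo.add_self_eq_zero x

def sh (a : Fin D → ℕ) (i : Fin D) : Fin D → ℕ := fun j => if j = i then a j + 1 else a j

def up (a : Fin D → ℕ) (u : Finset (Fin D)) : Fin D → ℕ := fun j => if j ∈ u then a j + 1 else a j

def dl : Coch D →+ Coch D where
  toFun z := fun w a => ∑ i ∈ w, (z (w.erase i) (sh a i) + z (w.erase i) a)
  map_zero' := by ext w a; simp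
  map_add' x y := by
    ext w a
    simp only [Pi.add_apply, ← Finset.sum_add_distrib]
    exact Finset.sum_congr rfl (fun i _ => by ring)

lemma dl_apply (z : Coch D) (w : Finset (Fin D)) (a : Fin D → ℕ) :
    dl z w a = ∑ i ∈ w, (z (w.erase i) (sh a i) + z (w.erase i) a) := rfl

lemma csum_self {M : Type*} [AddCommGroup M] (h2 : ∀ x : M, x + x = 0) {ι : Type*} [DecidableEq ι]
    (A : Finset ι) (G : ι → ι → M) (hG : ∀ i j, G i j = G j i) :
    ∑ i ∈ A, ∑ j ∈ A.erase i, G i j = 0 := by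
  rw [Finset.sum_sigma']
  refine Finset.sum_involution (fun p _ => ⟨p.2, p.1⟩) ?_ ?_ ?_ ?_
  · rintro ⟨i, j⟩ h
    simp only
    rw [hG j i]; exact h2 _
  · rintro ⟨i, j⟩ h _ h'
    simp only [Finset.mem_sigma, Finset.mem_erase] at h
    simp only [Sigma.mk.injEq] at h'
    exact h.2.1 h'.1
  · rintro ⟨i, j⟩ h
    simp only [Finset.mem_sigma, Finset.mem_erase] at h ⊢
    exact ⟨h.2.2, fun e => h.2.1 e.symm, h.1⟩
  · rintro ⟨i, j⟩ h; rfl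

lemma sh_comm (a : Fin D → ℕ) (i j : Fin D) : sh (sh a i) j = sh (sh a j) i := by
  ext l; simp only [sh]; split_ifs <;> rfl

lemma dl_dl (z : Coch D) : dl (dl z) = 0 := by
  ext w a
  simp only [dl_apply, Pi.zero_apply, ← Finset.sum_add_distrib]
  refine csum_self z2 w (fun i j => z ((w.erase i).erase j) (sh (sh a i) j) + z ((w.erase i).erase j) (sh a i) + (z ((w.erase i).erase j) (sh a j) + z ((w.erase i).erase j) a)) ?_
  intro i j
  simp only [Finset.erase_right_comm (a := i) (b := j), sh_comm a i j]
  ring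

def deg (z : Coch D) (j : ℕ) : Prop := ∀ w a, w.card ≠ j → z w a = 0

lemma deg_add {x y : Coch D} {j : ℕ} (hx : deg x j) (hy : deg y j) : deg (x + y) j := by
  intro w a h; simp [hx w a h, hy w a h]

lemma deg_zero (j : ℕ) : deg (0 : Coch D) j := by
  intro w a h; simp

lemma deg_sum {ι : Type*} (s : Finset ι) (f : ι → Coch D) {j : ℕ} (h : ∀ i ∈ s, deg (f i) j) :
    deg (∑ i ∈ s, f i) j := by
  intro w a hw
  simp only [Finset.sum_apply]
  exact Finset.sum_eq_zero fun i hi => h i hi w a hw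

lemma deg_dl {x : Coch D} {j : ℕ} (hx : deg x j) : deg (dl x) (j+1) := by
  intro w a h
  rw [dl_apply]
  refine Finset.sum_eq_zero fun i hi => ?_
  have : (w.erase i).card ≠ j := by
    have := Finset.card_erase_add_one hi
    omega
  simp [hx _ _ this]

/-! contraction operators -/

def K (i : Fin D) (p : ℕ) (z : Coch D) : Coch D := fun w a =>
  if i ∈ w then 0 else
    ∑ t ∈ Finset.range (a i), z (insert i w) (update a i t)
      + ∑ t ∈ Finset.range p, z (insert i w) (update a i t)

def P (i : Fin D) (p : ℕ) (z : Coch D) : Coch D := fun w a =>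
  if i ∈ w then 0 else z w (update a i p)

lemma upd_sh_ne (a : Fin D → ℕ) {i l : Fin D} (h : l ≠ i) (t : ℕ) :
    update (sh a l) i t = sh (update a i t) l := by
  ext j; simp only [sh, update_apply]; split_ifs <;> simp_all

lemma upd_sh_eq (a : Fin D → ℕ) (i : Fin D) (t : ℕ) :
    update (sh a i) i t = update a i t := by
  ext j; simp only [sh, update_apply]; split_ifs <;> simp_all

lemma sh_upd (a : Fin D → ℕ) (i : Fin D) (t : ℕ) :
    sh (update a i t) i = update a i (t+1) := by
  ext j; simp only [sh, update_apply]; split_ifs <;> simp_all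

lemma tele (f : ℕ → ZMod 2) (n : ℕ) :
    ∑ t ∈ Finset.range n, (f (t+1) + f t) = f n + f 0 := by
  induction n with
  | zero => simp [z2]
  | succ n ih =>
    rw [Finset.sum_range_succ, ih]
    linear_combination z2 (f n)

lemma sh_ne (a : Fin D → ℕ) {i l : Fin D} (h : l ≠ i) : sh a l i = a i := by
  simp [sh, h.symm]

lemma sh_self (a : Fin D → ℕ) (i : Fin D) : sh a i i = a i + 1 := by
  simp [sh]

lemma P_dl (i : Fin D) (p : ℕ) (z : Coch D) : dl (P i p z) = P i p (dl z) := by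
  ext w a
  by_cases hi : i ∈ w
  · have : P i p (dl z) w a = 0 := by simp [P, hi]
    rw [this, dl_apply]
    refine Finset.sum_eq_zero fun l hl => ?_
    by_cases hli : l = i
    · subst hli
      simp [P, upd_sh_eq, z2]
    · have : i ∈ w.erase l := Finset.mem_erase.2 ⟨fun h => hli h.symm, hi⟩
      simp [P, this]
  · have : P i p (dl z) w a = dl z w (update a i p) := by simp [P, hi]
    rw [this, dl_apply, dl_apply]
    refine Finset.sum_congr rfl fun l hl => ?_
    have hli : l ≠ i := fun h => hi (h ▸ hl)
    simp [P, hi, upd_sh_ne a hli]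

lemma K_dl (i : Fin D) (p : ℕ) (z : Coch D) : dl (K i p z) + K i p (dl z) = z + P i p z := by
  ext w a
  simp only [Pi.add_apply]
  by_cases hi : i ∈ w
  · have h1 : P i p z w a = 0 := by simp [P, hi]
    have h2 : K i p (dl z) w a = 0 := by simp [K, hi]
    rw [h1, h2, dl_apply, Finset.sum_eq_single i]
    · simp only [K, Finset.notMem_erase, if_false, sh_self, Finset.sum_range_succ, upd_sh_eq,
        Finset.insert_erase hi, update_eq_self]
      linear_combination z2 (∑ x ∈ Finset.range (a i), z w (update a i x)) +
        z2 (∑ x ∈ Finset.range p, z w (update a i x))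
    · intro l hl hli
      have : i ∈ w.erase l := Finset.mem_erase.2 ⟨fun h => hli h.symm, hi⟩
      simp [K, this]
    · intro h; exact absurd hi h
  · have key : ∀ n, ∑ t ∈ Finset.range n, dl z (insert i w) (update a i t)
        = z w (update a i n) + z w (update a i 0) +
        ∑ l ∈ w, ∑ t ∈ Finset.range n, (z (insert i (w.erase l)) (update (sh a l) i t)
          + z (insert i (w.erase l)) (update a i t)) := by
      intro n
      rw [← tele (fun t => z w (update a i t)), Finset.sum_comm, ← Finset.sum_add_distrib]
      refine Finset.sum_congr rfl fun t _ => ?_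
      rw [dl_apply, Finset.sum_insert hi, Finset.erase_insert hi, sh_upd]
      congr 1
      refine Finset.sum_congr rfl fun l hl => ?_
      have hli : l ≠ i := fun h => hi (h ▸ hl)
      rw [Finset.erase_insert_of_ne hli.symm, upd_sh_ne a hli]
    have h1 : P i p z w a = z w (update a i p) := by simp [P, hi]
    have h2 : K i p (dl z) w a = z w a + z w (update a i p) +
        ∑ l ∈ w, (∑ t ∈ Finset.range (a i), (z (insert i (w.erase l)) (update (sh a l) i t)
          + z (insert i (w.erase l)) (update a i t)) +
          ∑ t ∈ Finset.range p, (z (insert i (w.erase l)) (update (sh a l) i t)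
          + z (insert i (w.erase l)) (update a i t))) := by
      simp only [K, hi, if_false]
      rw [key, key, Finset.sum_add_distrib, update_eq_self]
      linear_combination z2 (z w (update a i 0))
    have h3 : dl (K i p z) w a = ∑ l ∈ w, (∑ t ∈ Finset.range (a i), (z (insert i (w.erase l)) (update (sh a l) i t)
          + z (insert i (w.erase l)) (update a i t)) +
          ∑ t ∈ Finset.range p, (z (insert i (w.erase l)) (update (sh a l) i t)
          + z (insert i (w.erase l)) (update a i t))) := by
      rw [dl_apply]
      refine Finset.sum_congr rfl fun l hl => ?_
      have hli : l ≠ i := fun h => hi (h ▸ hl)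
      have : i ∉ w.erase l := fun h => hi (Finset.mem_of_mem_erase h)
      simp only [K, this, if_false, sh_ne a hli, Finset.sum_add_distrib]
      ring
    rw [h1, h2, h3]
    linear_combination z2 (∑ l ∈ w, (∑ t ∈ Finset.range (a i), (z (insert i (w.erase l)) (update (sh a l) i t)
          + z (insert i (w.erase l)) (update a i t)) +
          ∑ t ∈ Finset.range p, (z (insert i (w.erase l)) (update (sh a l) i t)
          + z (insert i (w.erase l)) (update a i t))))

/-! sizes -/

def inb (S : ℕ) (c : Finset (Fin D) × (Fin D → ℕ)) : Prop :=
  ∀ i, c.2 i ≤ S ∧ (i ∈ c.1 → c.2 i + 1 ≤ S)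

noncomputable def supp (S : ℕ) (z : Coch D) : Finset (Finset (Fin D) × (Fin D → ℕ)) :=
  (Finset.univ ×ˢ Fintype.piFinset (fun _ => Finset.range (S+1))).filter
    (fun c => inb S c ∧ z c.1 c.2 ≠ 0)

lemma mem_supp {S : ℕ} {z : Coch D} {c : Finset (Fin D) × (Fin D → ℕ)} :
    c ∈ supp S z ↔ inb S c ∧ z c.1 c.2 ≠ 0 := by
  simp only [supp, Finset.mem_filter, Finset.mem_product, Finset.mem_univ, true_and,
    Fintype.mem_piFinset, Finset.mem_range, and_iff_right_iff_imp]
  intro h i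
  have := (h.1 i).1
  omega

noncomputable def sz (S : ℕ) (z : Coch D) : ℕ := (supp S z).card

lemma sz_add (S : ℕ) (x y : Coch D) : sz S (x + y) ≤ sz S x + sz S y := by
  refine (Finset.card_le_card ?_).trans (Finset.card_union_le _ _)
  intro c hc
  rw [Finset.mem_union, mem_supp, mem_supp]
  rw [mem_supp] at hc
  by_contra h
  push Not at h
  exact hc.2 (by simp [h.1 hc.1, h.2 hc.1])

lemma sz_zero (S : ℕ) : sz S (0 : Coch D) = 0 := by
  rw [sz, Finset.card_eq_zero, Finset.eq_empty_iff_forall_notMem]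
  intro c hc; rw [mem_supp] at hc; exact hc.2 rfl

lemma sz_sum (S : ℕ) {ι : Type*} (s : Finset ι) (f : ι → Coch D) :
    sz S (∑ i ∈ s, f i) ≤ ∑ i ∈ s, sz S (f i) := by
  classical
  induction s using Finset.induction_on with
  | empty => simp [sz_zero]
  | insert i s hi ih =>
    rw [Finset.sum_insert hi, Finset.sum_insert hi]
    exact (sz_add _ _ _).trans (by omega)

lemma deg_K {z : Coch D} {j : ℕ} (i : Fin D) (p : ℕ) (hz : deg z (j+1)) : deg (K i p z) j := by
  intro w a h
  by_cases hi : i ∈ w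
  · simp [K, hi]
  · have : (insert i w).card ≠ j + 1 := by rw [Finset.card_insert_of_notMem hi]; omega
    simp [K, hi, hz _ _ this]

lemma deg_P {z : Coch D} {j : ℕ} (i : Fin D) (p : ℕ) (hz : deg z j) : deg (P i p z) j := by
  intro w a h
  simp [P, hz _ _ h]

lemma sz_K (S : ℕ) (i : Fin D) (p : ℕ) (hp : p ≤ S) (z : Coch D) :
    sz S (K i p z) ≤ (S+1) * sz S z := by
  have : supp S (K i p z) ⊆ (supp S z ×ˢ Finset.range (S+1)).image
      (fun q => (q.1.1.erase i, update q.1.2 i q.2)) := by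
    rintro ⟨w, a⟩ hc
    rw [mem_supp] at hc
    obtain ⟨hb, hz⟩ := hc
    simp only [] at hz
    by_cases hi : i ∈ w
    · simp [K, hi] at hz
    have : ∃ t < S, z (insert i w) (update a i t) ≠ 0 := by
      by_contra h
      push Not at h
      apply hz
      simp only [K, hi, if_false]
      rw [Finset.sum_eq_zero, Finset.sum_eq_zero, add_zero]
      · intro t ht; exact h t (by rw [Finset.mem_range] at ht; omega)
      · intro t ht; exact h t (by rw [Finset.mem_range] at ht; have := (hb i).1; simp only at this; omega)
    obtain ⟨t, ht, hzt⟩ := this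
    rw [Finset.mem_image]
    refine ⟨((insert i w, update a i t), a i), ?_, ?_⟩
    · rw [Finset.mem_product, mem_supp, Finset.mem_range]
      refine ⟨⟨?_, hzt⟩, ?_⟩
      · intro l
        by_cases hl : l = i
        · subst hl; simp; omega
        · simpa [hl] using hb l
      · have := (hb i).1; simp only at this ⊢; omega
    · simp [hi]
  refine (Finset.card_le_card this).trans (Finset.card_image_le.trans ?_)
  rw [Finset.card_product, Finset.card_range, mul_comm]; rfl

lemma sz_P (S : ℕ) (i : Fin D) (z : Coch D) :
    ∃ p ≤ S, sz S (P i p z) ≤ sz S z := by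
  obtain ⟨p, hp, hcard⟩ : ∃ p ∈ Finset.range (S+1),
      (S+1) * ((supp S z).filter (fun c => c.2 i = p)).card ≤ (supp S z).card := by
    by_contra h
    push Not at h
    have h1 : ∑ p ∈ Finset.range (S+1), ((supp S z).filter (fun c => c.2 i = p)).card = (supp S z).card := by
      refine (Finset.card_eq_sum_card_fiberwise ?_).symm
      intro c hc
      have := ((mem_supp.1 hc).1 i).1
      simp; omega
    have h2 := Finset.sum_lt_sum_of_nonempty (s := Finset.range (S+1)) (by simp) h
    rw [← Finset.mul_sum, h1] at h2
    simp at h2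
  refine ⟨p, by simpa [Nat.lt_succ_iff] using hp, ?_⟩
  refine le_trans ?_ hcard
  have : supp S (P i p z) ⊆ (((supp S z).filter (fun c => c.2 i = p)) ×ˢ Finset.range (S+1)).image
      (fun q => (q.1.1, update q.1.2 i q.2)) := by
    rintro ⟨w, a⟩ hc
    rw [mem_supp] at hc
    obtain ⟨hb, hz⟩ := hc
    simp only [] at hz
    by_cases hi : i ∈ w
    · simp [P, hi] at hz
    simp only [P, hi, if_false] at hz
    rw [Finset.mem_image]
    refine ⟨((w, update a i p), a i), ?_, ?_⟩
    · rw [Finset.mem_product, Finset.mem_filter, mem_supp, Finset.mem_range]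
      refine ⟨⟨⟨?_, hz⟩, by simp⟩, ?_⟩
      · intro l
        by_cases hl : l = i
        · subst hl; simp at hp; simp [hi]; omega
        · simpa [hl] using hb l
      · have := (hb i).1; simp only at this ⊢; omega
    · simp
  refine (Finset.card_le_card this).trans (Finset.card_image_le.trans ?_)
  rw [Finset.card_product, Finset.card_range, mul_comm]

lemma fill_aux (S : ℕ) (z : Coch D) (j : ℕ) (hd : deg z (j+1)) (hz : dl z = 0)
    (T : Finset (Fin D)) : ∃ b z' : Coch D, deg b j ∧ deg z' (j+1) ∧ dl z' = 0 ∧ dl b + z' = z ∧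
      sz S z' ≤ sz S z ∧ sz S b ≤ T.card * ((S+1) * sz S z) ∧
      ∀ w a, ∀ i ∈ T, i ∈ w → z' w a = 0 := by
  induction T using Finset.induction_on with
  | empty => exact ⟨0, z, deg_zero _, hd, hz, by simp, le_rfl, by simp [sz_zero], by simp⟩
  | insert i T hi ih =>
    obtain ⟨b, z', h1, h2, h3, h4, h5, h6, h7⟩ := ih
    obtain ⟨p, hp, hsz⟩ := sz_P S i z'
    refine ⟨b + K i p z', P i p z', deg_add h1 (deg_K i p h2), deg_P i p h2, ?_, ?_, hsz.trans h5, ?_, ?_⟩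
    · rw [P_dl, h3]; ext w a; simp [P]
    · have hK := K_dl i p z'
      have h0 : K i p (0 : Coch D) = 0 := by ext w a; simp [K]
      rw [h3, h0, add_zero] at hK
      rw [map_add, hK, ← h4]
      ext w a
      simp only [Pi.add_apply]
      linear_combination z2 (P i p z' w a)
    · rw [Finset.card_insert_of_notMem hi]
      refine (sz_add _ _ _).trans ?_
      have := (sz_K S i p hp z').trans (Nat.mul_le_mul_left (S+1) h5)
      rw [add_mul, one_mul]; omega
    · intro w a l hl hlw
      by_cases hiw : i ∈ w
      · simp [P, hiw]
      · simp only [P, hiw, if_false]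
        rcases Finset.mem_insert.1 hl with rfl | hl
        · exact absurd hlw hiw
        · exact h7 w _ l hl hlw

lemma fill (S : ℕ) (z : Coch D) (j : ℕ) (hd : deg z (j+1)) (hz : dl z = 0) :
    ∃ b : Coch D, deg b j ∧ dl b = z ∧ sz S b ≤ D * ((S+1) * sz S z) := by
  obtain ⟨b, z', h1, h2, h3, h4, h5, h6, h7⟩ := fill_aux S z j hd hz Finset.univ
  have : z' = 0 := by
    ext w a
    by_cases hw : w.card = j+1
    · obtain ⟨i, hi⟩ := Finset.card_pos.1 (by omega : 0 < w.card)
      exact h7 w a i (Finset.mem_univ _) hi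
    · exact h2 w a hw
  subst this
  exact ⟨b, h1, by simpa using h4, by simpa using h6⟩

lemma const_of_dl (z : Coch D) (hz : dl z = 0) (a : Fin D → ℕ) : z ∅ a = z ∅ 0 := by
  have h1 : ∀ a i, z ∅ (sh a i) = z ∅ a := by
    intro a i
    have := congrFun (congrFun hz {i}) a
    simp only [dl_apply, Finset.sum_singleton, Finset.erase_singleton, Pi.zero_apply] at this
    linear_combination this - z2 (z ∅ a)
  have h2 : ∀ n (a : Fin D → ℕ), ∑ i, a i = n → z ∅ a = z ∅ 0 := by
    intro n
    induction n with
    | zero =>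
      intro a ha
      have : a = 0 := by ext i; simpa using (Finset.sum_eq_zero_iff.1 ha) i (Finset.mem_univ _)
      rw [this]
    | succ n ih =>
      intro a ha
      have : ∃ i, a i ≠ 0 := by
        by_contra h; push Not at h; simp [h] at ha
      obtain ⟨i, hi⟩ := this
      have e : a = sh (update a i (a i - 1)) i := by
        rw [sh_upd, Nat.sub_add_cancel (Nat.pos_of_ne_zero hi), update_eq_self]
      rw [e, h1]
      apply ih
      have := Finset.sum_update_of_mem (Finset.mem_univ i) a (a i - 1)
      rw [this]
      have h3 := Finset.add_sum_erase Finset.univ a (Finset.mem_univ i)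
      rw [Finset.sdiff_singleton_eq_erase]
      omega
  exact h2 _ a rfl

lemma zero_of_small (S : ℕ) (z : Coch D) (hz : dl z = 0) (hs : sz S z < (S+1)^D) : z ∅ 0 = 0 := by
  by_contra h
  have : (Fintype.piFinset (fun _ : Fin D => Finset.range (S+1))).image (fun a => ((∅ : Finset (Fin D)), a)) ⊆ supp S z := by
    intro c hc
    obtain ⟨a, ha, rfl⟩ := Finset.mem_image.1 hc
    rw [mem_supp]
    refine ⟨fun i => ⟨?_, by simp⟩, by simpa [const_of_dl z hz] using h⟩
    have := Fintype.mem_piFinset.1 ha i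
    simp at this ⊢; omega
  have h2 := Finset.card_le_card this
  rw [Finset.card_image_of_injective _ (fun a b h => by simpa using h)] at h2
  simp at h2
  unfold sz at hs
  omega

end Coch

namespace Coch
variable {D : ℕ}

def cup (x y : Coch D) : Coch D := fun w a =>
  ∑ u ∈ w.powerset, x u a * y (w \ u) (up a u)

lemma reindexA {α M : Type*} [DecidableEq α] [AddCommMonoid M] (w : Finset α)
    (f : α → Finset α → M) :
    ∑ u ∈ w.powerset, ∑ i ∈ u, f i (u.erase i) = ∑ i ∈ w, ∑ u ∈ (w.erase i).powerset, f i u := by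
  rw [Finset.sum_sigma', Finset.sum_sigma']
  refine Finset.sum_bij' (fun p _ => ⟨p.2, p.1.erase p.2⟩) (fun p _ => ⟨insert p.1 p.2, p.1⟩) ?_ ?_ ?_ ?_ ?_
  · rintro ⟨u, i⟩ h
    simp only [Finset.mem_sigma, Finset.mem_powerset] at h ⊢
    exact ⟨h.1 h.2, Finset.erase_subset_erase _ h.1⟩
  · rintro ⟨i, u⟩ h
    simp only [Finset.mem_sigma, Finset.mem_powerset] at h ⊢
    exact ⟨Finset.insert_subset h.1 (h.2.trans (Finset.erase_subset _ _)), Finset.mem_insert_self _ _⟩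
  · rintro ⟨u, i⟩ h
    simp only [Finset.mem_sigma, Finset.mem_powerset] at h ⊢
    simp [Finset.insert_erase h.2]
  · rintro ⟨i, u⟩ h
    simp only [Finset.mem_sigma, Finset.mem_powerset] at h ⊢
    have : i ∉ u := fun hi => by simpa using h.2 hi
    simp [Finset.erase_insert this]
  · rintro ⟨u, i⟩ h
    rfl

lemma cup_add_left (x x' y : Coch D) : cup (x + x') y = cup x y + cup x' y := by
  ext w a; simp [cup, add_mul, Finset.sum_add_distrib]

lemma cup_add_right (x y y' : Coch D) : cup x (y + y') = cup x y + cup x y' := by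
  ext w a; simp [cup, mul_add, Finset.sum_add_distrib]

lemma cup_zero_right (x : Coch D) : cup x 0 = 0 := by
  ext w a; simp [cup]

lemma cup_zero_left (x : Coch D) : cup 0 x = 0 := by
  ext w a; simp [cup]

lemma cup_sum_left {ι : Type*} (s : Finset ι) (f : ι → Coch D) (y : Coch D) :
    cup (∑ i ∈ s, f i) y = ∑ i ∈ s, cup (f i) y := by
  classical
  induction s using Finset.induction_on with
  | empty => simp [cup_zero_left]
  | insert i s hi ih => rw [Finset.sum_insert hi, Finset.sum_insert hi, cup_add_left, ih]

lemma leibniz (x y : Coch D) : dl (cup x y) = cup (dl x) y + cup x (dl y) := by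
  ext w a
  have e1 : cup (dl x) y w a = ∑ i ∈ w, ∑ u ∈ (w.erase i).powerset,
      (x u (sh a i) + x u a) * y ((w.erase i) \ u) (up (sh a i) u) := by
    rw [← reindexA w (fun i u => (x u (sh a i) + x u a) * y ((w.erase i) \ u) (up (sh a i) u))]
    unfold cup
    refine Finset.sum_congr rfl fun u hu => ?_
    rw [dl_apply, Finset.sum_mul]
    refine Finset.sum_congr rfl fun i hi => ?_
    have h1 : w \ u = (w.erase i) \ (u.erase i) := by
      ext j; simp only [Finset.mem_sdiff, Finset.mem_erase]
      by_cases hj : j = i <;> simp [hj, hi]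
    have h2 : up a u = up (sh a i) (u.erase i) := by
      ext j; simp only [up, sh, Finset.mem_erase]
      by_cases hj : j = i <;> simp [hj, hi]
    rw [h1, h2]
  have e2 : cup x (dl y) w a = ∑ i ∈ w, ∑ u ∈ (w.erase i).powerset,
      x u a * (y ((w.erase i) \ u) (up (sh a i) u) + y ((w.erase i) \ u) (up a u)) := by
    unfold cup
    simp only [dl_apply, Finset.mul_sum]
    rw [Finset.sum_comm' (t' := w) (s' := fun i => (w.erase i).powerset)]
    · refine Finset.sum_congr rfl fun i hi => Finset.sum_congr rfl fun u hu => ?_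
      rw [Finset.mem_powerset] at hu
      have hiu : i ∉ u := fun h => by simpa using hu h
      have h1 : (w \ u).erase i = (w.erase i) \ u := by
        ext j; simp only [Finset.mem_sdiff, Finset.mem_erase]; tauto
      have h2 : sh (up a u) i = up (sh a i) u := by
        ext j; simp only [up, sh]
        by_cases hj : j = i <;> simp [hj, hiu]
      rw [h1, h2]
    · intro u i
      simp only [Finset.mem_powerset, Finset.mem_sdiff, Finset.subset_erase]
      tauto
  rw [Pi.add_apply, Pi.add_apply, e1, e2, dl_apply, ← Finset.sum_add_distrib]
  refine Finset.sum_congr rfl fun i hi => ?_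
  unfold cup
  rw [← Finset.sum_add_distrib, ← Finset.sum_add_distrib]
  refine Finset.sum_congr rfl fun u hu => ?_
  linear_combination -z2 (x u a * y ((w.erase i) \ u) (up (sh a i) u))

lemma deg_cup {x y : Coch D} {i j : ℕ} (hx : deg x i) (hy : deg y j) : deg (cup x y) (i + j) := by
  intro w a h
  refine Finset.sum_eq_zero fun u hu => ?_
  rw [Finset.mem_powerset] at hu
  by_cases h1 : u.card = i
  · have : (w \ u).card ≠ j := by
      have := Finset.card_sdiff_add_card_eq_card hu
      omega
    rw [hy _ _ this, mul_zero]
  · rw [hx _ _ h1, zero_mul]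

def z0 (g : (Fin D → ℕ) → ZMod 2) : Coch D := fun w a => if w = ∅ then g a else 0

lemma deg_z0 (g : (Fin D → ℕ) → ZMod 2) : deg (z0 g) 0 := by
  intro w a h
  have : w ≠ ∅ := fun e => h (by simp [e])
  simp [z0, this]

lemma dl_one : dl (z0 (fun _ => 1) : Coch D) = 0 := by
  ext w a
  rw [dl_apply]
  refine Finset.sum_eq_zero fun i _ => ?_
  simp only [z0]; exact z2 _

def inC (w : Finset (Fin D)) (a v : Fin D → ℕ) : Prop := ∀ j, a j ≤ v j ∧ v j ≤ up a w j

lemma inC_self (w : Finset (Fin D)) (a : Fin D → ℕ) : inC w a a := by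
  intro j; simp only [up]; split_ifs <;> omega

section fam
variable {k N : ℕ} (φ : (Fin D → ℕ) → Fin k → Fin (N+1))

def gg (i : Fin k) (n : Fin (N+1)) : Coch D := z0 (fun v => if n ≤ φ v i then 1 else 0)
def ee (i : Fin k) (n : Fin (N+1)) : Coch D := z0 (fun v => if φ v i = n then 1 else 0)

lemma dl_ee (i : Fin k) (n : Fin (N+1)) :
    dl (ee φ i n) = dl (gg φ i n) + dl (gg φ i (n+1)) := by
  by_cases hn : n = Fin.last N
  · have h1 : gg φ i (n+1) = z0 (fun _ => 1) := by
      subst hn; simp [gg]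
    have h2 : ee φ i n = gg φ i n := by
      subst hn; simp [gg, ee, Fin.last_le_iff]
    rw [h1, h2, dl_one, add_zero]
  · rw [← map_add]
    congr 1
    ext w a
    simp only [ee, gg, z0, Pi.add_apply]
    split_ifs with h1 h2 h3 h4 h5 h6 <;> first | rfl | skip
    all_goals
      exfalso
      rw [Fin.le_iff_val_le_val] at *
      rw [Fin.ext_iff] at *
      rw [Fin.val_add_one] at *
      simp only [Fin.ext_iff] at *
      simp_all
      try omega

noncomputable def ff (i : Fin k) (e : Prop) (n : Fin (N+1)) : Coch D :=
  if e then dl (gg φ i n) else ee φ i n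

lemma ff_supp (i : Fin k) (e : Prop) (n : Fin (N+1)) (w : Finset (Fin D)) (a : Fin D → ℕ)
    (h : ff φ i e n w a ≠ 0) :
    ∃ v v', inC w a v ∧ inC w a v' ∧ φ v i ≤ n ∧ n ≤ φ v' i := by
  unfold ff at h
  split_ifs at h with he
  · rw [dl_apply] at h
    obtain ⟨l, hl, h⟩ := Finset.exists_ne_zero_of_sum_ne_zero h
    have hsh : inC w a (sh a l) := by
      intro j; simp only [sh, up]
      by_cases hj : j = l
      · subst hj; simp [hl]
      · simp only [hj, if_false]; split_ifs <;> omega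
    simp only [gg, z0] at h
    by_cases h1 : w.erase l = ∅
    · simp only [h1, if_true] at h
      by_cases h2 : n ≤ φ a i <;> by_cases h3 : n ≤ φ (sh a l) i
      · exact absurd (by simp [h2, h3, z2]) h
      · exact ⟨_, _, hsh, inC_self w a, le_of_lt (not_le.1 h3), h2⟩
      · exact ⟨_, _, inC_self w a, hsh, le_of_lt (not_le.1 h2), h3⟩
      · exact absurd (by simp [h2, h3]) h
    · exact absurd (by simp [h1]) h
  · simp only [ee, z0] at h
    split_ifs at h with h1 h2
    · exact ⟨a, a, inC_self w a, inC_self w a, h2.le, h2.ge⟩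
    all_goals exact absurd rfl h

lemma fam_exists (T : Finset (Fin k)) :
    ∃ c : Finset (Fin k) → (Fin k → Fin (N+1)) → Coch D,
      (∀ J n, dl (c J n) = ∑ i ∈ T \ J, (c (insert i J) n + c (insert i J) (update n i (n i + 1)))) ∧
      (∀ J n, deg (c J n) (J ∩ T).card) ∧
      (∀ J n w a, c J n w a ≠ 0 → ∀ i ∈ T, ∃ v v', inC w a v ∧ inC w a v' ∧ φ v i ≤ n i ∧ n i ≤ φ v' i) ∧
      (∀ n a, c ∅ n ∅ a = ∏ i ∈ T, if φ a i = n i then 1 else 0) ∧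
      (∀ J n, ∀ i ∉ T, c (insert i J) n = c J n) ∧
      (∀ J n x, ∀ i ∉ T, c J (update n i x) = c J n) := by
  induction T using Finset.induction_on with
  | empty =>
    refine ⟨fun _ _ => z0 (fun _ => 1), ?_, ?_, ?_, ?_, ?_, ?_⟩
    · intro J n; simp [dl_one]
    · intro J n; simpa using deg_z0 _
    · simp
    · simp [z0]
    · simp
    · simp
  | insert t T ht ih =>
    obtain ⟨c, h1, h2, h3, h4, h5, h6⟩ := ih
    refine ⟨fun J n => cup (c J n) (ff φ t (t ∈ J) (n t)), ?_, ?_, ?_, ?_, ?_, ?_⟩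
    · intro J n
      rw [leibniz, h1, cup_sum_left]
      have hA : ∀ i ∈ T \ J, cup (c (insert i J) n + c (insert i J) (update n i (n i + 1))) (ff φ t (t ∈ J) (n t))
          = cup (c (insert i J) n) (ff φ t (t ∈ insert i J) (n t)) +
            cup (c (insert i J) (update n i (n i + 1))) (ff φ t (t ∈ insert i J) (update n i (n i + 1) t)) := by
        intro i hi
        have hit : t ≠ i := fun h => ht (h ▸ (Finset.mem_sdiff.1 hi).1)
        rw [cup_add_left, update_of_ne hit, Finset.mem_insert]
        simp [hit]
      rw [Finset.sum_congr rfl hA]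
      by_cases hJ : t ∈ J
      · have : insert t T \ J = T \ J := by
          rw [Finset.insert_sdiff_of_mem _ hJ]
        rw [this]
        simp [ff, hJ, dl_dl, cup_zero_right]
      · rw [Finset.insert_sdiff_of_notMem _ hJ, Finset.sum_insert (by simp [ht]), add_comm]
        congr 1
        beta_reduce
        rw [h5 _ _ t ht, h5 _ _ t ht, h6 _ _ _ t ht]
        simp only [ff, hJ, if_false, Finset.mem_insert_self, if_true, update_self, dl_ee, cup_add_right]
    · intro J n
      have hf : deg (ff φ t (t ∈ J) (n t)) (if t ∈ J then 1 else 0) := by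
        unfold ff
        split_ifs
        · exact deg_dl (deg_z0 _)
        · exact deg_z0 _
      convert deg_cup (h2 J n) hf using 1
      split_ifs with hJ
      · rw [Finset.inter_insert_of_mem hJ, Finset.card_insert_of_notMem (by simp [ht])]
      · rw [Finset.inter_insert_of_notMem hJ, add_zero]
    · intro J n w a h i hi
      obtain ⟨u, hu, hne⟩ := Finset.exists_ne_zero_of_sum_ne_zero h
      rw [Finset.mem_powerset] at hu
      rcases Finset.mem_insert.1 hi with rfl | hi
      · obtain ⟨v, v', hv, hv', e⟩ := ff_supp φ _ _ _ _ _ (right_ne_zero_of_mul hne)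
        have aux : ∀ v, inC (w \ u) (up a u) v → inC w a v := by
          intro v hv j
          have := hv j
          simp only [up, Finset.mem_sdiff] at this ⊢
          have hh := @hu j
          by_cases hju : j ∈ u
          · have := hh hju; simp_all; omega
          · simp_all
        exact ⟨v, v', aux v hv, aux v' hv', e⟩
      · obtain ⟨v, v', hv, hv', e⟩ := h3 J n _ _ (left_ne_zero_of_mul hne) i hi
        have aux : ∀ v, inC u a v → inC w a v := by
          intro v hv j
          have := hv j
          simp only [up] at this ⊢
          have hh := @hu j
          by_cases hju : j ∈ u
          · have := hh hju; simp_all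
          · simp only [hju, if_false] at this; split_ifs <;> omega
        exact ⟨v, v', aux v hv, aux v' hv', e⟩
    · intro n a
      have : up a ∅ = a := by ext j; simp [up]
      simp only [cup, Finset.powerset_empty, Finset.sum_singleton, h4, Finset.prod_insert ht,
        Finset.notMem_empty, ff, if_false, ee, z0, Finset.sdiff_empty, if_true, this]
      rw [mul_comm]
    · intro J n i hi
      have hit : t ≠ i := fun h => hi (h ▸ Finset.mem_insert_self _ _)
      have hiT : i ∉ T := fun h => hi (Finset.mem_insert_of_mem h)
      simp only [h5 J n i hiT, Finset.mem_insert, hit, false_or]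
    · intro J n x i hi
      have hit : t ≠ i := fun h => hi (h ▸ Finset.mem_insert_self _ _)
      have hiT : i ∉ T := fun h => hi (Finset.mem_insert_of_mem h)
      simp only [h6 J n x i hiT, update_of_ne hit]

end fam

/-! homotopy argument -/
section hom
variable {k N : ℕ}

def Dl (b : Finset (Fin k) → (Fin k → Fin (N+1)) → Coch D) :
    Finset (Fin k) → (Fin k → Fin (N+1)) → Coch D :=
  fun J n => ∑ i ∈ Jᶜ, (b (insert i J) n + b (insert i J) (update n i (n i + 1)))

lemma c2 (x : Coch D) : x + x = 0 := by ext w a; exact z2 _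

lemma Dl_Dl (b : Finset (Fin k) → (Fin k → Fin (N+1)) → Coch D) : Dl (Dl b) = 0 := by
  ext1 J; ext1 n
  have : ∀ i ∈ Jᶜ, Dl b (insert i J) n + Dl b (insert i J) (update n i (n i + 1)) =
      ∑ j ∈ (Jᶜ).erase i, (b (insert j (insert i J)) n + b (insert j (insert i J)) (update n j (n j + 1))
        + (b (insert j (insert i J)) (update n i (n i + 1)) +
           b (insert j (insert i J)) (update (update n i (n i + 1)) j (n j + 1)))) := by
    intro i hi
    unfold Dl
    rw [← Finset.sum_add_distrib, Finset.compl_insert]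
    refine Finset.sum_congr rfl fun j hj => ?_
    rw [update_of_ne (Finset.mem_erase.1 hj).1]
  change ∑ i ∈ Jᶜ, (Dl b (insert i J) n + Dl b (insert i J) (update n i (n i + 1))) = 0
  rw [Finset.sum_congr rfl this]
  refine csum_self c2 _ (fun i j => (b (insert j (insert i J)) n + b (insert j (insert i J)) (update n j (n j + 1))
        + (b (insert j (insert i J)) (update n i (n i + 1)) +
           b (insert j (insert i J)) (update (update n i (n i + 1)) j (n j + 1))))) ?_
  intro i j
  by_cases hij : i = j
  · rw [hij]
  simp only [Finset.insert_comm i j J, update_comm hij]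
  abel

lemma dl_Dl (b : Finset (Fin k) → (Fin k → Fin (N+1)) → Coch D) (J n) :
    dl (Dl b J n) = Dl (fun J n => dl (b J n)) J n := by
  simp only [Dl, map_sum, map_add]

lemma Dl_add (b c : Finset (Fin k) → (Fin k → Fin (N+1)) → Coch D) : 
    Dl (b + c) = Dl b + Dl c := by
  ext1 J; ext1 n
  simp only [Dl, Pi.add_apply, ← Finset.sum_add_distrib]
  exact Finset.sum_congr rfl fun i _ => by abel

lemma Dl_congr {b c : Finset (Fin k) → (Fin k → Fin (N+1)) → Coch D} (J)
    (h : ∀ i ∉ J, ∀ n, b (insert i J) n = c (insert i J) n) (n) : Dl b J n = Dl c J n := by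
  unfold Dl
  refine Finset.sum_congr rfl fun i hi => ?_
  have hi := Finset.mem_compl.1 hi
  rw [h i hi, h i hi]

lemma dl_c_Dl {b c : Finset (Fin k) → (Fin k → Fin (N+1)) → Coch D} (J n)
    (hc : ∀ J n, dl (c J n) = Dl c J n)
    (hb : ∀ i ∉ J, ∀ n, dl (b (insert i J) n) = c (insert i J) n + Dl b (insert i J) n) :
    dl (c J n + Dl b J n) = 0 := by
  rw [map_add, hc, dl_Dl, Dl_congr (b := fun J n => dl (b J n)) (c := c + Dl b) J (fun i hi n => hb i hi n), Dl_add, Dl_Dl, add_zero, c2]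

lemma sz_Dl (S : ℕ) (b : Finset (Fin k) → (Fin k → Fin (N+1)) → Coch D) (J n) (B : ℕ)
    (h : ∀ i ∉ J, ∀ n, sz S (b (insert i J) n) ≤ B) : sz S (Dl b J n) ≤ 2 * k * B := by
  refine (sz_sum _ _ _).trans ?_
  refine (Finset.sum_le_card_nsmul _ _ (2 * B) ?_).trans ?_
  · intro i hi
    have hi := Finset.mem_compl.1 hi
    refine (sz_add _ _ _).trans ?_
    have := h i hi n
    have := h i hi (update n i (n i + 1))
    omega
  · have : (Jᶜ).card ≤ k := (Finset.card_le_univ _).trans (by simp)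
    rw [smul_eq_mul]
    nlinarith

lemma hom_aux (S Λ : ℕ) (c : Finset (Fin k) → (Fin k → Fin (N+1)) → Coch D) (hD : 1 ≤ D)
    (hc : ∀ J n, dl (c J n) = Dl c J n) (hdeg : ∀ J n, deg (c J n) J.card)
    (hsz : ∀ J n, sz S (c J n) ≤ Λ) (d : ℕ) :
    ∃ b : Finset (Fin k) → (Fin k → Fin (N+1)) → Coch D, ∀ J n, 1 ≤ J.card → k < J.card + d →
      deg (b J n) (J.card - 1) ∧ dl (b J n) = c J n + Dl b J n ∧
      sz S (b J n) ≤ (D * (1 + 2 * k) * (S + 1)) ^ (k + 1 - J.card) * Λ := by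
  induction d with
  | zero =>
    refine ⟨0, fun J n _ h => ?_⟩
    have : J.card ≤ k := (Finset.card_le_univ _).trans (by simp)
    omega
  | succ d ih =>
    obtain ⟨b, hb⟩ := ih
    have key : ∀ J n, 1 ≤ J.card → J.card + d = k → ∃ x : Coch D, deg x (J.card - 1) ∧
        dl x = c J n + Dl b J n ∧ sz S x ≤ (D * (1 + 2 * k) * (S + 1)) ^ (k + 1 - J.card) * Λ := by
      intro J n h1 h2
      have hins : ∀ i ∉ J, (insert i J).card = J.card + 1 := fun i hi => Finset.card_insert_of_notMem hi
      have hb' : ∀ i ∉ J, ∀ n, _ := fun i hi n => hb (insert i J) n (by rw [hins i hi]; omega) (by rw [hins i hi]; omega)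
      obtain ⟨x, hx1, hx2, hx3⟩ := fill S (c J n + Dl b J n) (J.card - 1) (by
        rw [Nat.sub_add_cancel h1]
        refine deg_add (hdeg J n) (deg_sum _ _ fun i hi => ?_)
        have hi := Finset.mem_compl.1 hi
        have e : (insert i J).card - 1 = J.card := by rw [hins i hi]; omega
        have e1 := (hb' i hi n).1
        have e2 := (hb' i hi (update n i (n i + 1))).1
        rw [e] at e1 e2
        exact deg_add e1 e2) (dl_c_Dl J n hc (fun i hi n => (hb' i hi n).2.1))
      refine ⟨x, hx1, hx2, hx3.trans ?_⟩
      set A := D * (1 + 2 * k) * (S + 1) with hA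
      have hs : sz S (Dl b J n) ≤ 2 * k * (A ^ d * Λ) := by
        refine sz_Dl S b J n _ fun i hi n => ?_
        have := (hb' i hi n).2.2
        rwa [hins i hi, show k + 1 - (J.card + 1) = d by omega] at this
      have hA1 : 1 ≤ A ^ d := Nat.one_le_pow _ _ (by positivity)
      have hs2 : sz S (c J n + Dl b J n) ≤ (1 + 2 * k) * (A ^ d * Λ) := by
        refine (sz_add _ _ _).trans ?_
        have := hsz J n
        nlinarith
      rw [show k + 1 - J.card = d + 1 by omega, pow_succ]
      calc D * ((S + 1) * sz S (c J n + Dl b J n)) ≤ D * ((S+1) * ((1 + 2 * k) * (A ^ d * Λ))) := by gcongr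
        _ = _ := by rw [hA]; ring
    choose! x hx using key
    refine ⟨fun J n => if J.card + d = k then x J n else b J n, ?_⟩
    intro J n h1 h2
    have e : Dl (fun J n => if J.card + d = k then x J n else b J n) J n = Dl b J n := by
      apply Dl_congr
      intro i hi n
      have : (insert i J).card + d ≠ k := by rw [Finset.card_insert_of_notMem hi]; omega
      simp [this]
    rw [e]
    by_cases h : J.card + d = k
    · simp only [h, if_true]
      exact hx J n h1 h
    · simp only [h, if_false]
      exact hb J n h1 (by omega)

lemma hom (S Λ : ℕ) (c : Finset (Fin k) → (Fin k → Fin (N+1)) → Coch D) (hD : 1 ≤ D)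
    (hc : ∀ J n, dl (c J n) = Dl c J n) (hdeg : ∀ J n, deg (c J n) J.card)
    (hsz : ∀ J n, sz S (c J n) ≤ Λ) (h1 : ∑ n, c ∅ n ∅ 0 = 1) :
    (S+1)^D ≤ (1 + 2 * k) * ((D * (1 + 2 * k) * (S + 1)) ^ k * Λ) := by
  obtain ⟨b, hb⟩ := hom_aux S Λ c hD hc hdeg hsz k
  have hb' : ∀ i ∉ (∅ : Finset (Fin k)), ∀ n, _ := fun i _ n => hb (insert i ∅) n (by simp) (by simp)
  by_contra hlt
  push Not at hlt
  have hz : ∀ n, (c ∅ n + Dl b ∅ n) ∅ 0 = 0 := by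
    intro n
    apply zero_of_small S _ (dl_c_Dl ∅ n hc (fun i hi n => (hb' i hi n).2.1))
    refine lt_of_le_of_lt ?_ hlt
    set A := D * (1 + 2 * k) * (S + 1) with hA
    have hs : sz S (Dl b ∅ n) ≤ 2 * k * (A ^ k * Λ) := by
      refine sz_Dl S b ∅ n _ fun i hi n => ?_
      have := (hb' i hi n).2.2
      simpa using this
    have hA1 : 1 ≤ A ^ k := Nat.one_le_pow _ _ (by positivity)
    refine (sz_add _ _ _).trans ?_
    have := hsz ∅ n
    nlinarith
  have hsum : ∑ n, (c ∅ n + Dl b ∅ n) ∅ 0 = 0 := Finset.sum_eq_zero fun n _ => hz n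
  suffices hDl : ∑ n, Dl b ∅ n ∅ 0 = 0 by
    simp only [Pi.add_apply, Finset.sum_add_distrib, h1, hDl] at hsum
    simp at hsum
  simp only [Dl, Finset.sum_apply, Pi.add_apply]
  rw [Finset.sum_comm]
  refine Finset.sum_eq_zero ?_
  intro i _
  rw [Finset.sum_add_distrib]
  have : ∑ n : Fin k → Fin (N+1), b (insert i ∅) (update n i (n i + 1)) ∅ 0 = ∑ n, b (insert i ∅) n ∅ 0 := by
    have := Equiv.sum_comp (Equiv.addRight (Pi.single i (1 : Fin (N+1)) : Fin k → Fin (N+1))) (fun n => b (insert i ∅) n ∅ 0)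
    rw [← this]
    refine Finset.sum_congr rfl fun n _ => ?_
    congr 2
    ext j
    by_cases hj : j = i
    · subst hj; simp
    · simp [hj]
  rw [this, z2]

end hom

/-! subdivision -/

def sd1 (M : ℕ) (i : Fin D) (c : Coch D) : Coch D := fun w a =>
  if i ∈ w then ∑ t ∈ Finset.range M, c w (update a i (M * a i + t)) else c w (update a i (M * a i))

lemma dl_sd1 (M : ℕ) (i : Fin D) (c : Coch D) : dl (sd1 M i c) = sd1 M i (dl c) := by
  ext w a
  by_cases hi : i ∈ w
  · have h1 : sd1 M i (dl c) w a = ∑ t ∈ Finset.range M, dl c w (update a i (M * a i + t)) := by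
      simp [sd1, hi]
    rw [h1]
    simp only [dl_apply]
    rw [Finset.sum_comm]
    refine Finset.sum_congr rfl fun l hl => ?_
    by_cases hli : l = i
    · subst hli
      have := tele (fun t => c (w.erase l) (update a l (M * a l + t))) M
      simp only [sh_upd, add_assoc] at this ⊢
      rw [this]
      simp [sd1, sh_self, upd_sh_eq, mul_add]
    · have : i ∈ w.erase l := Finset.mem_erase.2 ⟨fun h => hli h.symm, hi⟩
      simp only [sd1, this, if_true, sh_ne a hli, upd_sh_ne a hli, Finset.sum_add_distrib]
  · have h1 : sd1 M i (dl c) w a = dl c w (update a i (M * a i)) := by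
      simp [sd1, hi]
    rw [h1, dl_apply, dl_apply]
    refine Finset.sum_congr rfl fun l hl => ?_
    have hli : l ≠ i := fun h => hi (h ▸ hl)
    have : i ∉ w.erase l := fun h => hi (Finset.mem_of_mem_erase h)
    simp only [sd1, this, if_false, sh_ne a hli, upd_sh_ne a hli]

lemma sd1_add (M : ℕ) (i : Fin D) (x y : Coch D) : sd1 M i (x + y) = sd1 M i x + sd1 M i y := by
  ext w a
  simp only [sd1, Pi.add_apply]
  split_ifs
  · rw [Finset.sum_add_distrib]
  · rfl

lemma sd_exists (M : ℕ) (T : Finset (Fin D)) : ∃ s : Coch D →+ Coch D,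
    (∀ c, dl (s c) = s (dl c)) ∧ (∀ c j, deg c j → deg (s c) j) ∧
    (∀ c w a, s c w a ≠ 0 → ∃ b, c w b ≠ 0 ∧ ∀ i, (i ∈ T → i ∈ w → M * a i ≤ b i ∧ b i + 1 ≤ M * a i + M) ∧
      (i ∈ T → i ∉ w → b i = M * a i) ∧ (i ∉ T → b i = a i)) ∧
    (∀ c, s c ∅ 0 = c ∅ 0) := by
  induction T using Finset.induction_on with
  | empty =>
    refine ⟨AddMonoidHom.id _, fun _ => rfl, fun _ _ h => h, fun c w a h => ⟨a, h, by simp⟩, fun _ => rfl⟩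
  | insert t T ht ih =>
    obtain ⟨s, h1, h2, h3, h4⟩ := ih
    refine ⟨(AddMonoidHom.mk' (sd1 M t) (sd1_add M t)).comp s, ?_, ?_, ?_, ?_⟩
    · intro c; simp [dl_sd1, h1]
    · intro c j hc w a hw
      simp [sd1, h2 c j hc w _ hw]
    · intro c w a h
      simp only [AddMonoidHom.comp_apply, AddMonoidHom.mk'_apply] at h
      by_cases htw : t ∈ w
      · simp only [sd1, htw, if_true] at h
        obtain ⟨r, hr, h⟩ := Finset.exists_ne_zero_of_sum_ne_zero h
        obtain ⟨b, hb, hb'⟩ := h3 _ _ _ h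
        refine ⟨b, hb, fun i => ?_⟩
        have := hb' i
        rw [Finset.mem_range] at hr
        by_cases hit : i = t
        · subst hit
          simp only [ht, update_self, htw] at this ⊢
          simp at this ⊢
          omega
        · simpa [hit] using this
      · simp only [sd1, htw, if_false] at h
        obtain ⟨b, hb, hb'⟩ := h3 _ _ _ h
        refine ⟨b, hb, fun i => ?_⟩
        have := hb' i
        by_cases hit : i = t
        · subst hit
          simp only [ht, update_self, htw] at this ⊢
          simp at this ⊢
          omega
        · simpa [hit] using this
    · intro c
      have : update (0 : Fin D → ℕ) t 0 = 0 := by simp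
      simp [sd1, this, h4]

/-- combinatorial main theorem -/
lemma comb {k N : ℕ} (S Λ M : ℕ) (hD : 1 ≤ D) (φ : (Fin D → ℕ) → Fin k → Fin (N+1))
    (h : ∀ n : Fin k → Fin (N+1), ∃ A : Finset (Finset (Fin D) × (Fin D → ℕ)), A.card ≤ Λ ∧
      ∀ w a, inb S (w, a) → w.card ≤ k → ∀ b : Fin D → ℕ,
        (∀ i, (i ∈ w → M * a i ≤ b i ∧ b i + 1 ≤ M * a i + M) ∧ (i ∉ w → b i = M * a i)) →
        (∀ i, ∃ v v', inC w b v ∧ inC w b v' ∧ φ v i ≤ n i ∧ n i ≤ φ v' i) → (w, a) ∈ A) :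
    (S+1)^D ≤ (1 + 2 * k) * ((D * (1 + 2 * k) * (S + 1)) ^ k * Λ) := by
  obtain ⟨c, h1, h2, h3, h4, -, -⟩ := fam_exists φ Finset.univ
  obtain ⟨s, s1, s2, s3, s4⟩ := sd_exists (D := D) M Finset.univ
  refine hom S Λ (fun J n => s (c J n)) hD ?_ ?_ ?_ ?_
  · intro J n
    rw [s1, h1, map_sum]
    simp only [Dl, map_add, Finset.compl_eq_univ_sdiff]
  · intro J n
    apply s2
    simpa using h2 J n
  · intro J n
    obtain ⟨A, hA, hA'⟩ := h n
    refine le_trans (Finset.card_le_card ?_) hA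
    rintro ⟨w, a⟩ hwa
    obtain ⟨hb, hne⟩ := mem_supp.1 hwa
    obtain ⟨b, hb1, hb2⟩ := s3 _ _ _ hne
    refine hA' w a hb ?_ b (fun i => ⟨(hb2 i).1 (Finset.mem_univ _), (hb2 i).2.1 (Finset.mem_univ _)⟩) (fun i => h3 J n w b hb1 i (Finset.mem_univ _))
    by_contra hw
    refine hb1 (h2 J n w b ?_)
    have := Finset.card_le_univ J
    simp at this ⊢
    omega
  · simp only [s4, h4]
    rw [Finset.sum_eq_single (φ 0)]
    · simp
    · intro n _ hn
      have : ∃ i, φ 0 i ≠ n i := by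
        by_contra h; push Not at h; exact hn (funext fun i => (h i).symm)
      obtain ⟨i, hi⟩ := this
      exact Finset.prod_eq_zero (Finset.mem_univ i) (by simp [hi])
    · simp

end Coch

namespace Coch

lemma dist_le_of_coord {n : ℕ} (x y : EuclideanSpace ℝ (Fin n)) (r : ℝ) (hr : 0 ≤ r)
    (h : ∀ i, |x i - y i| ≤ r) : dist x y ≤ r * n := by
  rw [EuclideanSpace.dist_eq]
  apply Real.sqrt_le_iff.2
  refine ⟨by positivity, ?_⟩
  calc ∑ i, dist (x i) (y i) ^ 2 ≤ ∑ _i : Fin n, r ^ 2 := by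
        refine Finset.sum_le_sum fun i _ => ?_
        rw [Real.dist_eq]
        exact pow_le_pow_left₀ (abs_nonneg _) (h i) 2
    _ = n * r ^ 2 := by simp
    _ ≤ (r * n) ^ 2 := by
        have : (n : ℝ) ≤ (n : ℝ) ^ 2 := by exact_mod_cast Nat.le_self_pow (by norm_num) n
        nlinarith [sq_nonneg r]

lemma gridFace_closed (D : ℕ) (w : Finset (Fin D)) (a : Fin D → ℕ) : IsClosed (gridFace D w a) := by
  have : gridFace D w a = ⋂ i : Fin D, ({x | i ∈ w → x i ∈ Set.Icc (a i : ℝ) ((a i : ℝ) + 1)} ∩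
      {x | i ∉ w → x i = (a i : ℝ)}) := by
    ext x; simp [gridFace]
  rw [this]
  refine isClosed_iInter fun i => IsClosed.inter ?_ ?_
  · by_cases h : i ∈ w
    · simp only [h, true_imp_iff]
      exact isClosed_Icc.preimage (by fun_prop : Continuous fun x : EuclideanSpace ℝ (Fin D) => x i)
    · simp [h]
  · by_cases h : i ∈ w
    · simp [h]
    · simp only [h, not_false_eq_true, true_imp_iff]
      exact isClosed_eq (by fun_prop) (by fun_prop)

lemma cells_finite (D S : ℕ) : {c : Finset (Fin D) × (Fin D → ℕ) | inb S c}.Finite := by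
  refine Set.Finite.subset (Finset.finite_toSet
    (Finset.univ ×ˢ Fintype.piFinset (fun _ : Fin D => Finset.range (S+1)))) ?_
  intro c hc
  simp only [Finset.coe_product, Finset.coe_univ, Set.mem_prod, Set.mem_univ, true_and,
    Finset.mem_coe, Fintype.mem_piFinset, Finset.mem_range]
  intro i
  have := (hc i).1
  omega

lemma inb_iff {D S : ℕ} (w : Finset (Fin D)) (a : Fin D → ℕ) :
    inb S (w, a) ↔ (∀ i ∈ w, a i + 1 ≤ S) ∧ (∀ i : Fin D, i ∉ w → a i ≤ S) := by
  constructor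
  · intro h
    exact ⟨fun i hi => (h i).2 hi, fun i _ => (h i).1⟩
  · rintro ⟨h1, h2⟩ i
    refine ⟨?_, h1 i⟩
    by_cases hi : i ∈ w
    · have := h1 i hi; simp only; omega
    · exact h2 i hi

lemma skel_eq (k D S : ℕ) : gridSkeleton k D S =
    ⋃ c ∈ {c : Finset (Fin D) × (Fin D → ℕ) | inb S c ∧ c.1.card ≤ k}, gridFace D c.1 c.2 := by
  ext x
  simp only [gridSkeleton, IsGridFace, Set.mem_ofPred_eq, Set.mem_iUnion, Prod.exists]
  constructor
  · rintro ⟨j, hj, f, ⟨w, hw, a, h1, h2, rfl⟩, hx⟩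
    exact ⟨w, a, ⟨(inb_iff w a).2 ⟨h1, h2⟩, by omega⟩, hx⟩
  · rintro ⟨w, a, ⟨h1, h2⟩, hx⟩
    exact ⟨w.card, h2, _, ⟨w, rfl, a, ((inb_iff w a).1 h1).1, ((inb_iff w a).1 h1).2, rfl⟩, hx⟩

lemma face_sub_skel {k D S : ℕ} {w : Finset (Fin D)} {a : Fin D → ℕ} (h : inb S (w, a))
    (hw : w.card ≤ k) : gridFace D w a ⊆ gridSkeleton k D S := by
  rw [skel_eq]
  exact Set.subset_biUnion_of_mem (u := fun c : Finset (Fin D) × (Fin D → ℕ) => gridFace D c.1 c.2)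
    (show (w, a) ∈ {c : Finset (Fin D) × (Fin D → ℕ) | inb S c ∧ c.1.card ≤ k} from ⟨h, hw⟩)

lemma skel_compact (k D S : ℕ) : IsCompact (gridSkeleton k D S) := by
  apply Metric.isCompact_of_isClosed_isBounded
  · rw [skel_eq]
    refine Set.Finite.isClosed_biUnion ((cells_finite D S).subset fun c hc => hc.1) ?_
    intro c _
    exact gridFace_closed _ _ _
  · refine (Metric.isBounded_closedBall (x := (0 : EuclideanSpace ℝ (Fin D))) (r := S * D)).subset ?_
    intro x hx
    rw [skel_eq] at hx
    simp only [Set.mem_iUnion] at hx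
    obtain ⟨c, hc, hx⟩ := hx
    rw [Metric.mem_closedBall]
    refine dist_le_of_coord _ _ _ (by positivity) fun i => ?_
    have h1 := hx i
    have h2 := hc.1 i
    simp only [PiLp.zero_apply, sub_zero]
    by_cases hi : i ∈ c.1
    · have h3 := h1.1 hi
      have h4 : (c.2 i : ℝ) + 1 ≤ S := by exact_mod_cast h2.2 hi
      have h5 : (0 : ℝ) ≤ c.2 i := by positivity
      rw [abs_le]; constructor <;> linarith [h3.1, h3.2]
    · rw [h1.2 hi, abs_of_nonneg (by positivity)]
      exact_mod_cast h2.1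

lemma extend_face {k D S : ℕ} (hD : k < D) (hS : 1 ≤ S) (c : Finset (Fin D) × (Fin D → ℕ))
    (hc : inb S c) (hk : c.1.card ≤ k) :
    ∃ f, IsGridFace k D S f ∧ gridFace D c.1 c.2 ⊆ f := by
  obtain ⟨w, a⟩ := c
  obtain ⟨w', hw', hcard⟩ := Finset.exists_superset_card_eq hk (by simp; omega : k ≤ Fintype.card (Fin D))
  let a' : Fin D → ℕ := fun i => if i ∈ w' ∧ a i = S then S - 1 else a i
  refine ⟨gridFace D w' a', ⟨w', hcard, a', ?_, ?_, rfl⟩, ?_⟩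
  · intro i hi
    have := (hc i).1
    simp only [a', hi, true_and] at this ⊢
    split_ifs <;> omega
  · intro i hi
    simpa [a', hi] using (hc i).1
  · intro x hx i
    have h1 := hx i
    have h2 := hc i
    simp only at h1 h2
    constructor
    · intro hi
      simp only [a', hi, true_and]
      by_cases hiw : i ∈ w
      · have h3 := h2.2 hiw
        have : a i ≠ S := by omega
        simpa [this] using h1.1 hiw
      · rw [h1.2 hiw]
        split_ifs with h
        · rw [h, Nat.cast_sub hS]; constructor <;> simp
        · constructor <;> simp
    · intro hi
      have hiw : i ∉ w := fun h => hi (hw' h)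
      simpa [a', hi] using h1.2 hiw

lemma card_cells {k D S L : ℕ} (hD : k < D) (hS : 1 ≤ S)
    (A : Finset (Finset (Fin D) × (Fin D → ℕ))) (B : Set (Set (EuclideanSpace ℝ (Fin D))))
    (hB : B.Finite) (hL : B.ncard ≤ L)
    (hA : ∀ c ∈ A, inb S c ∧ c.1.card ≤ k)
    (hAB : ∀ c ∈ A, ∀ f, IsGridFace k D S f → gridFace D c.1 c.2 ⊆ f → f ∈ B) :
    A.card ≤ 4 ^ D * L := by
  classical
  have := fun (c : Finset (Fin D) × (Fin D → ℕ)) (hc : inb S c ∧ c.1.card ≤ k) =>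
    extend_face hD hS c hc.1 hc.2
  choose! f hf hsub using this
  have h1 : A.card ≤ 4 ^ D * (A.image f).card := by
    refine Finset.card_le_mul_card_image A (4 ^ D) ?_
    intro g hg
    obtain ⟨c0, hc0, rfl⟩ := Finset.mem_image.1 hg
    obtain ⟨w', -, a', -, -, hfa⟩ := hf c0 (hA c0 hc0)
    have hss : A.filter (fun c => f c = f c0) ⊆
        Finset.univ ×ˢ Fintype.piFinset (fun i => ({a' i, a' i + 1} : Finset ℕ)) := by
      rintro ⟨w, a⟩ hc
      rw [Finset.mem_filter] at hc
      simp only [Finset.mem_product, Finset.mem_univ, true_and, Fintype.mem_piFinset,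
        Finset.mem_insert, Finset.mem_singleton]
      have hp : (WithLp.toLp 2 (fun i => (a i : ℝ)) : EuclideanSpace ℝ (Fin D)) ∈ gridFace D w a := by
        intro i; simp
      have hp2 := hsub _ (hA _ hc.1) hp
      rw [hc.2, hfa] at hp2
      intro i
      have h3 := hp2 i
      simp only at h3
      by_cases hi : i ∈ w'
      · have h4 := h3.1 hi
        have h5 : a' i ≤ a i := by exact_mod_cast h4.1
        have h6 : a i ≤ a' i + 1 := by exact_mod_cast h4.2
        omega
      · left; exact_mod_cast h3.2 hi
    refine (Finset.card_le_card hss).trans ?_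
    rw [Finset.card_product, Fintype.card_piFinset]
    have : ∀ i, ({a' i, a' i + 1} : Finset ℕ).card = 2 := fun i => Finset.card_pair (by omega)
    simp only [this, Finset.card_univ, Fintype.card_finset, Fintype.card_fin, Finset.prod_const]
    rw [← mul_pow]
    norm_num
  refine h1.trans (Nat.mul_le_mul_left _ (le_trans ?_ hL))
  rw [← Set.ncard_coe_finset]
  refine Set.ncard_le_ncard ?_ hB
  intro g hg
  obtain ⟨c, hc, rfl⟩ := Finset.mem_image.1 (Finset.mem_coe.1 hg)
  exact hAB c hc _ (hf c (hA c hc)) (hsub c (hA c hc))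

lemma kfaces_finite (k D S : ℕ) : {f : Set (EuclideanSpace ℝ (Fin D)) | IsGridFace k D S f}.Finite := by
  refine ((cells_finite D S).image (fun c => gridFace D c.1 c.2)).subset ?_
  rintro f ⟨w, hw, a, h1, h2, rfl⟩
  exact ⟨(w, a), (inb_iff w a).2 ⟨h1, h2⟩, rfl⟩

lemma kface_closed {k D S : ℕ} {f : Set (EuclideanSpace ℝ (Fin D))} (hf : IsGridFace k D S f) :
    IsClosed f := by
  obtain ⟨w, hw, a, h1, h2, rfl⟩ := hf
  exact gridFace_closed _ _ _

lemma leb {k D S : ℕ} (F : gridSkeleton k D S → EuclideanSpace ℝ (Fin k)) (hF : Continuous F) :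
    ∃ δ > 0, ∀ x0, ∃ y, ∀ f, IsGridFace k D S f → ∀ x : gridSkeleton k D S,
      (x : EuclideanSpace ℝ (Fin D)) ∈ f → dist (F x) (F x0) < δ →
      ∃ x' : gridSkeleton k D S, F x' = y ∧ (x' : EuclideanSpace ℝ (Fin D)) ∈ f := by
  have : CompactSpace (gridSkeleton k D S) := isCompact_iff_compactSpace.1 (skel_compact k D S)
  let U : EuclideanSpace ℝ (Fin k) → Set (EuclideanSpace ℝ (Fin k)) := fun y =>
    ⋂ f ∈ {f : Set (EuclideanSpace ℝ (Fin D)) | IsGridFace k D S f ∧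
      ¬ ∃ x' : gridSkeleton k D S, F x' = y ∧ (x' : EuclideanSpace ℝ (Fin D)) ∈ f},
      (F '' {x | (x : EuclideanSpace ℝ (Fin D)) ∈ f})ᶜ
  have hU : ∀ y, IsOpen (U y) := by
    intro y
    refine Set.Finite.isOpen_biInter ((kfaces_finite k D S).subset fun f hf => hf.1) ?_
    intro f hf
    rw [isOpen_compl_iff]
    have : IsClosed {x : gridSkeleton k D S | (x : EuclideanSpace ℝ (Fin D)) ∈ f} :=
      (kface_closed hf.1).preimage continuous_subtype_val
    exact (this.isCompact.image hF).isClosed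
  have hy : ∀ y, y ∈ U y := by
    intro y
    simp only [U, Set.mem_iInter]
    rintro f hf ⟨x, hx, hxy⟩
    exact hf.2 ⟨x, hxy, hx⟩
  obtain ⟨δ, hδ, h⟩ := lebesgue_number_lemma_of_metric (isCompact_range hF) hU
    (fun y _ => Set.mem_iUnion.2 ⟨y, hy y⟩)
  refine ⟨δ, hδ, fun x0 => ?_⟩
  obtain ⟨y, hyb⟩ := h (F x0) ⟨x0, rfl⟩
  refine ⟨y, fun f hf x hx hd => ?_⟩
  by_contra hcon
  have := hyb (Metric.mem_ball.2 hd)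
  simp only [U, Set.mem_iInter] at this
  exact this f ⟨hf, hcon⟩ ⟨x, hx, rfl⟩

lemma main_count {k D S L : ℕ} (hk : 1 ≤ k) (hD : k < D) (hS : 1 ≤ S)
    (F : gridSkeleton k D S → EuclideanSpace ℝ (Fin k)) (hF : Continuous F)
    (hL : ∀ y, {f : Set (EuclideanSpace ℝ (Fin D)) | IsGridFace k D S f ∧
                ∃ x : gridSkeleton k D S, F x = y ∧
                  (x : EuclideanSpace ℝ (Fin D)) ∈ f}.ncard ≤ L) :
    (S+1)^D ≤ (1 + 2 * k) * ((D * (1 + 2 * k) * (S + 1)) ^ k * (4 ^ D * L)) := by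
  have : CompactSpace (gridSkeleton k D S) := isCompact_iff_compactSpace.1 (skel_compact k D S)
  obtain ⟨δ, hδ, hleb⟩ := leb F hF
  obtain ⟨R, hR⟩ := (isCompact_range hF).isBounded.exists_norm_le
  have hR' : ∀ x i, |F x i| ≤ R := fun x i => by
    have h1 := PiLp.norm_apply_le (F x) i
    rw [Real.norm_eq_abs] at h1
    exact h1.trans (hR _ ⟨x, rfl⟩)
  have hk0 : (0 : ℝ) < k := by exact_mod_cast hk
  set η : ℝ := δ / (5 * k) with hη
  have hη0 : 0 < η := by positivity
  obtain ⟨ρ, hρ, huc⟩ := Metric.uniformContinuous_iff.1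
    (CompactSpace.uniformContinuous_of_continuous hF) η hη0
  obtain ⟨M, hM⟩ := exists_nat_gt (D / ρ)
  have hD0 : (0 : ℝ) < D := by exact_mod_cast (by omega : 0 < D)
  have hM0 : (0 : ℝ) < M := lt_trans (by positivity) hM
  have hMρ : 1 / (M : ℝ) * D < ρ := by
    rw [div_lt_iff₀ hρ] at hM
    rw [one_div, inv_mul_lt_iff₀ hM0]; exact hM
  let pt : (Fin D → ℕ) → EuclideanSpace ℝ (Fin D) := fun v => WithLp.toLp 2 (fun i => (v i : ℝ) / M)
  let N := ⌊2 * R / η⌋₊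
  let φ : (Fin D → ℕ) → Fin k → Fin (N + 1) := fun v i =>
    if h : pt v ∈ gridSkeleton k D S then
      ⟨min N ⌊(F ⟨pt v, h⟩ i + R) / η⌋₊, by omega⟩ else 0
  have hφ : ∀ v (h : pt v ∈ gridSkeleton k D S) i, ((φ v i : ℕ) : ℝ) * η ≤ F ⟨pt v, h⟩ i + R ∧
      F ⟨pt v, h⟩ i + R < ((φ v i : ℕ) + 1 : ℝ) * η := by
    intro v h i
    have hb := abs_le.1 (hR' ⟨pt v, h⟩ i)
    have e : (φ v i : ℕ) = ⌊(F ⟨pt v, h⟩ i + R) / η⌋₊ := by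
      simp only [φ, h, dif_pos]
      apply min_eq_right
      apply Nat.floor_mono
      gcongr
      linarith
    rw [e]
    constructor
    · rw [← le_div_iff₀ hη0]
      exact Nat.floor_le (div_nonneg (by linarith) hη0.le)
    · rw [← div_lt_iff₀ hη0]
      exact Nat.lt_floor_add_one _
  refine comb S (4 ^ D * L) M (by omega) φ ?_
  intro n
  let Aset : Set (Finset (Fin D) × (Fin D → ℕ)) := {c | inb S c ∧ c.1.card ≤ k ∧
    ∃ x : gridSkeleton k D S, (x : EuclideanSpace ℝ (Fin D)) ∈ gridFace D c.1 c.2 ∧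
      ∀ i, |F x i + R - (n i : ℕ) * η| ≤ 2 * η}
  have hfin : Aset.Finite := (cells_finite D S).subset fun c hc => hc.1
  refine ⟨hfin.toFinset, ?_, ?_⟩
  · by_cases hne : Aset.Nonempty
    · obtain ⟨c0, -, -, x0, -, hx0⟩ := hne
      obtain ⟨y, hy⟩ := hleb x0
      refine card_cells hD hS hfin.toFinset _ ((kfaces_finite k D S).subset fun f hf => hf.1) (hL y) ?_ ?_
      · intro c hc
        have hc := hfin.mem_toFinset.1 hc
        exact ⟨hc.1, hc.2.1⟩
      · intro c hc f hf hsub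
        obtain ⟨-, -, x, hx, hxn⟩ := hfin.mem_toFinset.1 hc
        refine ⟨hf, hy f hf x (hsub hx) ?_⟩
        have : dist (F x) (F x0) ≤ (4 * η) * k := by
          refine dist_le_of_coord _ _ _ (by positivity) fun i => ?_
          have h1 := abs_le.1 (hxn i)
          have h2 := abs_le.1 (hx0 i)
          rw [abs_le]; constructor <;> linarith [h1.1, h1.2, h2.1, h2.2]
        refine lt_of_le_of_lt this ?_
        have : 4 * η * k = 4 / 5 * δ := by rw [hη]; field_simp
        rw [this]; linarith
    · rw [Set.not_nonempty_iff_eq_empty] at hne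
      have : hfin.toFinset = ∅ := by rw [Set.Finite.toFinset_eq_empty]; exact hne
      rw [this]; simp
  · intro w a hin hw b hb hv
    rw [Set.Finite.mem_toFinset]
    have hptf : ∀ v, inC w b v → pt v ∈ gridFace D w a := by
      intro v hv i
      have h1 := hb i
      have h2 := hv i
      simp only [up] at h2
      simp only [pt]
      constructor
      · intro hi
        have h3 := h1.1 hi
        simp only [hi, if_true] at h2
        constructor
        · rw [le_div_iff₀ hM0]
          have : M * a i ≤ v i := by omega
          rw [mul_comm]; exact_mod_cast this
        · rw [div_le_iff₀ hM0]
          have : v i ≤ M * a i + M := by omega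
          have : (v i : ℝ) ≤ M * a i + M := by exact_mod_cast this
          linarith
      · intro hi
        have h3 := h1.2 hi
        simp only [hi, if_false] at h2
        have : v i = M * a i := by omega
        rw [this]; push_cast; field_simp
    have hsk := face_sub_skel hin hw
    have hbb := inC_self w b
    have hbs := hsk (hptf b hbb)
    have hclose : ∀ v (hv : inC w b v), ∀ i, |F ⟨pt v, hsk (hptf v hv)⟩ i - F ⟨pt b, hbs⟩ i| < η := by
      intro v hv i
      have hd : dist (pt v) (pt b) ≤ 1 / M * D := by
        refine dist_le_of_coord _ _ _ (by positivity) fun j => ?_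
        have h2 := hv j
        have h3 : b j ≤ v j ∧ v j ≤ b j + 1 := by
          refine ⟨h2.1, h2.2.trans ?_⟩
          simp only [up]; split_ifs <;> omega
        have h4 : (b j : ℝ) ≤ v j := by exact_mod_cast h3.1
        have h5 : (v j : ℝ) ≤ b j + 1 := by exact_mod_cast h3.2
        simp only [pt]
        rw [← sub_div, abs_div, abs_of_pos hM0]
        gcongr
        rw [abs_le]; constructor <;> linarith
      have := huc (show dist (⟨pt v, hsk (hptf v hv)⟩ : gridSkeleton k D S) ⟨pt b, hbs⟩ < ρ from lt_of_le_of_lt hd hMρ)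
      refine lt_of_le_of_lt ?_ this
      rw [dist_eq_norm]
      have h1 := PiLp.norm_apply_le (F ⟨pt v, hsk (hptf v hv)⟩ - F ⟨pt b, hbs⟩) i
      rwa [Real.norm_eq_abs] at h1
    refine ⟨hin, hw, ⟨pt b, hbs⟩, hptf b hbb, fun i => ?_⟩
    obtain ⟨v, v', h1, h2, h3, h4⟩ := hv i
    have e1 := abs_lt.1 (hclose v h1 i)
    have e2 := abs_lt.1 (hclose v' h2 i)
    have e3 := (hφ v (hsk (hptf v h1)) i).2
    have e4 := (hφ v' (hsk (hptf v' h2)) i).1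
    have e5 : ((φ v i : ℕ) : ℝ) ≤ (n i : ℕ) := by exact_mod_cast h3
    have e6 : ((n i : ℕ) : ℝ) ≤ (φ v' i : ℕ) := by exact_mod_cast h4
    have e7 := mul_le_mul_of_nonneg_right e5 hη0.le
    have e8 := mul_le_mul_of_nonneg_right e6 hη0.le
    rw [add_mul, one_mul] at e3
    rw [abs_le]; constructor <;> linarith [e1.1, e1.2, e2.1, e2.2]

end Coch

/-- Fix `D > k ≥ 1`.  There is `c(D, k) > 0` such that for every
`S ≥ 1` and every continuous map `F : X^{k,D}(S) → ℝᵏ` there is a point `y ∈ ℝᵏ`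
whose fiber meets at least `c(D, k) * S^(D-k)` distinct `k`-dimensional faces of
`X^{k,D}(S)`. -/
theorem statement8 (k D : ℕ) (hk : 1 ≤ k) (hD : k < D) :
    ∃ c : ℝ, 0 < c ∧
      ∀ S : ℕ, 1 ≤ S →
        ∀ F : gridSkeleton k D S → EuclideanSpace ℝ (Fin k), Continuous F →
          ∃ y : EuclideanSpace ℝ (Fin k),
            c * (S : ℝ) ^ (D - k) ≤
              ({f : Set (EuclideanSpace ℝ (Fin D)) | IsGridFace k D S f ∧
                ∃ x : gridSkeleton k D S, F x = y ∧
                  (x : EuclideanSpace ℝ (Fin D)) ∈ f}.ncard : ℝ) := by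
  set Q : ℕ := (1 + 2 * k) * ((D * (1 + 2 * k)) ^ k * 4 ^ D) with hQ
  have hD1 : 1 ≤ D := by omega
  have hQ0 : (0 : ℝ) < Q := by
    have : 0 < Q := by positivity
    exact_mod_cast this
  refine ⟨1 / (2 * Q), by positivity, ?_⟩
  intro S hS F hF
  by_contra hcon
  push Not at hcon
  have hL := Coch.main_count (L := ⌊1 / (2 * (Q : ℝ)) * (S : ℝ) ^ (D - k)⌋₊) hk hD hS F hF
    (fun y => Nat.le_floor (hcon y).le)
  set L := ⌊1 / (2 * (Q : ℝ)) * (S : ℝ) ^ (D - k)⌋₊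
  have hL2 : (L : ℝ) ≤ 1 / (2 * (Q : ℝ)) * (S : ℝ) ^ (D - k) := Nat.floor_le (by positivity)
  have h1 : (S+1)^D ≤ Q * (S+1)^k * L := by
    refine hL.trans (le_of_eq ?_)
    rw [hQ, mul_pow]; ring
  have h2 : ((S : ℝ)+1)^D ≤ Q * ((S : ℝ)+1)^k * L := by exact_mod_cast h1
  have h3 : (Q : ℝ) * L ≤ 1 / 2 * (S : ℝ) ^ (D - k) := by
    calc (Q : ℝ) * L ≤ Q * (1 / (2 * (Q : ℝ)) * (S : ℝ) ^ (D - k)) := by gcongr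
      _ = _ := by field_simp
  have h4 : (S : ℝ) ^ (D - k) ≤ ((S : ℝ) + 1) ^ (D - k) := by gcongr; linarith
  have h5 : ((S : ℝ) + 1) ^ D = ((S : ℝ) + 1) ^ k * ((S : ℝ) + 1) ^ (D - k) := by
    rw [← pow_add]; congr 1; omega
  have h6 : (0 : ℝ) < ((S : ℝ) + 1) ^ k := by positivity
  have h7 : (0 : ℝ) < ((S : ℝ) + 1) ^ (D - k) := by positivity
  have h8 : ((S : ℝ) + 1) ^ k * (Q * L) ≤ ((S : ℝ) + 1) ^ k * (1 / 2 * ((S : ℝ) + 1) ^ (D - k)) := by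
    exact mul_le_mul_of_nonneg_left (by linarith) h6.le
  nlinarith [mul_pos h6 h7]
end
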